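/- arXiv:1804.10532 — 9 statements merged into one kernel-verified Lean document; each statement's English description precedes it below -/
import Mathlib

section
/- Let t > 1 and n = 2t - 1 be integers, and let k ≥ 1. Then Ass(I^k) = Ass(I) = {⟨x_1⟩, ⟨x_3⟩, …, ⟨x_{2t-1}⟩}; that is, the associated prime ideals of I^k are exactly the principal ideals ⟨x_i⟩ generated by a single variable x_i with i odd, 1 ≤ i ≤ 2t - 1. -/
open MvPolynomial

/-- `F` is an independent set of the path graph `Pₙ` on vertices `x_1, …, x_n`
(encoded as `Fin n`, where `v : Fin n` corresponds to the vertex `x_{v+1}`):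
no two consecutive vertices belong to `F`. -/
def IsIndepSet (n : ℕ) (F : Finset (Fin n)) : Prop :=
  ∀ i ∈ F, ∀ j ∈ F, (i : ℕ) + 1 ≠ (j : ℕ)

/-- The ideal `Ind_t(Pₙ)` of `K[x_1, …, x_n]`, generated by all squarefree monomials
`x^F` where `F` is an independent set of the path graph `Pₙ` of size `t`. -/
noncomputable def indIdeal (K : Type*) [Field K] (n t : ℕ) :
    Ideal (MvPolynomial (Fin n) K) :=
  Ideal.span {m | ∃ F : Finset (Fin n), IsIndepSet n F ∧ F.card = t ∧ m = ∏ v ∈ F, X v}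

theorem isAssociatedPrime_quotient_span_singleton_iff {A : Type*} [CommRing A] {g : A}
    {P : Ideal A} :
    IsAssociatedPrime P (A ⧸ Ideal.span {g}) ↔
      P.IsPrime ∧ ∃ x : A, ∀ r, r ∈ P ↔ ∃ m : ℕ, g ∣ r ^ m * x := by
  have key (x r : A) :
      r ∈ (Submodule.colon (⊥ : Submodule A (A ⧸ Ideal.span {g}))
        {Ideal.Quotient.mk (Ideal.span {g}) x}).radical ↔ ∃ m : ℕ, g ∣ r ^ m * x := by
    simp only [Ideal.mem_radical_iff, Submodule.mem_colon_singleton, Submodule.mem_bot,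
      Algebra.smul_def, Ideal.Quotient.algebraMap_eq, ← map_mul, Ideal.Quotient.eq_zero_iff_mem,
      Ideal.mem_span_singleton]
  constructor
  · rintro ⟨hP, x, hx⟩
    obtain ⟨x, rfl⟩ := Ideal.Quotient.mk_surjective x
    exact ⟨hP, x, fun r => by rw [hx, key]⟩
  · rintro ⟨hP, x, hx⟩
    exact ⟨hP, Ideal.Quotient.mk _ x, Ideal.ext fun r => by rw [hx, key]⟩

/-- If a prime element `p` lies in an associated prime `P` of a principal ideal generated by a
nonzero element, then `P` is generated by `p`. -/
theorem IsAssociatedPrime.eq_span_singleton_of_prime_mem {A : Type*} [CommRing A] [IsDomain A]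
    {g p : A} {P : Ideal A} (hP : IsAssociatedPrime P (A ⧸ Ideal.span {g})) (hg : g ≠ 0)
    (hp : Prime p) (hpP : p ∈ P) : P = Ideal.span {p} := by
  classical
  obtain ⟨hP, x, hx⟩ := isAssociatedPrime_quotient_span_singleton_iff.1 hP
  refine le_antisymm (fun r hr => ?_) ((Ideal.span_singleton_le_iff_mem _).2 hpP)
  have hex : ∃ m : ℕ, g ∣ p ^ m * x := (hx p).1 hpP
  have hfind := Nat.find_spec hex
  have hmin := fun m => Nat.find_min hex (m := m)
  obtain ⟨m, hm⟩ : ∃ m, Nat.find hex = m + 1 := by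
    refine Nat.exists_eq_succ_of_ne_zero fun h => ?_
    rw [h] at hfind
    exact hP.ne_top ((Ideal.eq_top_iff_one _).2 ((hx 1).2 ⟨0, by simpa using hfind⟩))
  rw [hm] at hfind
  have hnot : ¬ g ∣ p ^ m * x := hmin m (by omega)
  obtain ⟨z, hz⟩ := hfind
  have hpz : ¬ p ∣ z := by
    rintro ⟨w, rfl⟩
    exact hnot ⟨w, mul_left_cancel₀ hp.ne_zero (by linear_combination hz)⟩
  obtain ⟨l, w, hw⟩ := (hx r).1 hr
  have hdvd : p ∣ r ^ l * z :=
    ⟨p ^ m * w, mul_left_cancel₀ hg (by linear_combination p ^ (m + 1) * hw - r ^ l * hz)⟩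
  exact Ideal.mem_span_singleton.2
    (hp.dvd_of_dvd_pow ((hp.dvd_or_dvd hdvd).resolve_right hpz))

/-- The associated primes of a positive power of a product of prime elements. -/
theorem associatedPrimes_quotient_span_prod_pow {A ι : Type*} [CommRing A] [IsDomain A]
    (s : Finset ι) (p : ι → A) (hp : ∀ i ∈ s, Prime (p i)) {k : ℕ} (hk : k ≠ 0) :
    associatedPrimes A (A ⧸ Ideal.span {∏ i ∈ s, p i} ^ k) =
      {P | ∃ i ∈ s, P = Ideal.span {p i}} := by
  classical
  rw [Ideal.span_singleton_pow]
  ext P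
  simp only [AssociatedPrimes.mem_iff, Set.mem_ofPred_eq]
  constructor
  · intro hP
    obtain ⟨hPprime, x, hx⟩ := isAssociatedPrime_quotient_span_singleton_iff.1 hP
    have hmem : ∏ i ∈ s, p i ∈ P := (hx _).2 ⟨k, dvd_mul_right _ _⟩
    obtain ⟨i, hi, hiP⟩ := (hPprime.prod_mem_iff).1 hmem
    exact ⟨i, hi, hP.eq_span_singleton_of_prime_mem
      (pow_ne_zero _ (Finset.prod_ne_zero_iff.2 fun j hj => (hp j hj).ne_zero)) (hp i hi) hiP⟩
  · rintro ⟨i, hi, rfl⟩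
    refine isAssociatedPrime_quotient_span_singleton_iff.2
      ⟨(Ideal.span_singleton_prime (hp i hi).ne_zero).2 (hp i hi),
        (∏ j ∈ s.erase i, p j) ^ k, fun r => ?_⟩
    have hne : (∏ j ∈ s.erase i, p j) ^ k ≠ 0 := pow_ne_zero _ (Finset.prod_ne_zero_iff.2
      fun j hj => (hp j (Finset.mem_of_mem_erase hj)).ne_zero)
    rw [← Finset.mul_prod_erase s p hi, mul_pow, Ideal.mem_span_singleton]
    simp only [mul_dvd_mul_iff_right hne]
    exact ⟨fun h => ⟨k, pow_dvd_pow_of_dvd h k⟩,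
      fun ⟨m, hm⟩ => (hp i hi).dvd_of_dvd_pow ((dvd_pow_self _ hk).trans hm)⟩

/-- The only independent set of size `t` of the path on `2t - 1` vertices is the set of
vertices of even index. -/
theorem isIndepSet_and_card_eq_iff {n t : ℕ} (hn : n = 2 * t - 1) (F : Finset (Fin n)) :
    IsIndepSet n F ∧ F.card = t ↔ F = Finset.univ.filter fun v : Fin n => Even (v : ℕ) := by
  have hcard : (Finset.univ.filter fun v : Fin n => Even (v : ℕ)).card = t := by
    rw [← Finset.card_range t]
    refine Finset.card_bij' (fun v _ => (v : ℕ) / 2)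
      (fun j hj => ⟨2 * j, by rw [Finset.mem_range] at hj; omega⟩) ?_ ?_ ?_ ?_
    · intro v _
      have := v.2
      simp only [Finset.mem_range]
      omega
    · intro j _
      simp
    · intro v hv
      have := (Finset.mem_filter.1 hv).2
      ext
      simp only
      grind
    · intro j _
      simp
  constructor
  · rintro ⟨hF, hFt⟩
    have hmaps : ∀ v ∈ F, (v : ℕ) / 2 ∈ Finset.range t := fun v _ => by
      have := v.2
      simp only [Finset.mem_range]
      omega
    have hinj : Set.InjOn (fun v : Fin n => (v : ℕ) / 2) F := fun v hv w hw h => by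
      have h₁ := hF v hv w hw
      have h₂ := hF w hw v hv
      ext
      simp only at h
      omega
    have hsurj : ∀ j < t, ∃ v ∈ F, (v : ℕ) / 2 = j := fun j hj => by
      obtain ⟨v, hv, h⟩ := Finset.surjOn_of_injOn_of_card_le (s := F) (t := Finset.range t)
        (fun v : Fin n => (v : ℕ) / 2) hmaps hinj (by simp [hFt])
        (Finset.mem_coe.2 (Finset.mem_range.2 hj))
      exact ⟨v, hv, h⟩
    have heven : ∀ d < t, ∃ v ∈ F, (v : ℕ) = 2 * (t - 1 - d) := by
      intro d
      induction d with
      | zero =>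
        intro hd
        obtain ⟨v, hv, h⟩ := hsurj (t - 1) (by omega)
        have := v.2
        exact ⟨v, hv, by omega⟩
      | succ d ih =>
        intro hd
        obtain ⟨w, hw, hw'⟩ := ih (by omega)
        obtain ⟨v, hv, h⟩ := hsurj (t - 1 - (d + 1)) (by omega)
        have := hF v hv w hw
        exact ⟨v, hv, by omega⟩
    refine (Finset.eq_of_subset_of_card_le (fun v hv => ?_) (by omega)).symm
    obtain ⟨j, hj⟩ := (Finset.mem_filter.1 hv).2
    have := v.2
    obtain ⟨w, hw, hw'⟩ := heven (t - 1 - j) (by omega)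
    rwa [show v = w from Fin.ext (by omega)]
  · rintro rfl
    refine ⟨fun i hi j hj h => ?_, hcard⟩
    have h₁ := (Finset.mem_filter.1 hi).2
    have h₂ := (Finset.mem_filter.1 hj).2
    grind

theorem indIdeal_eq_span_prod (K : Type*) [Field K] {n t : ℕ} (hn : n = 2 * t - 1) :
    indIdeal K n t =
      Ideal.span {∏ v ∈ Finset.univ.filter (fun v : Fin n => Even (v : ℕ)), X v} := by
  simp only [indIdeal, ← and_assoc, isIndepSet_and_card_eq_iff hn, exists_eq_left,
    Set.ofPred_eq_eq_singleton]

/-- If `n = 2t - 1` then for every `k ≥ 1`,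
`Ass(Iᵏ) = Ass(I) = {⟨x_i⟩ : i odd, 1 ≤ i ≤ 2t - 1}`.
A 1-based index `i` is odd iff the corresponding 0-based index `v = i - 1` is even. -/
theorem stmt0 (K : Type*) [Field K] (t n k : ℕ) (ht : 1 < t) (hn : n = 2 * t - 1)
    (hk : 1 ≤ k) :
    associatedPrimes (MvPolynomial (Fin n) K)
        (MvPolynomial (Fin n) K ⧸ (indIdeal K n t) ^ k) =
      associatedPrimes (MvPolynomial (Fin n) K)
        (MvPolynomial (Fin n) K ⧸ indIdeal K n t) ∧
    associatedPrimes (MvPolynomial (Fin n) K)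
        (MvPolynomial (Fin n) K ⧸ indIdeal K n t) =
      {P | ∃ v : Fin n, Even (v : ℕ) ∧ P = Ideal.span {X v}} := by
  have key (l : ℕ) (hl : l ≠ 0) := associatedPrimes_quotient_span_prod_pow
    (Finset.univ.filter fun v : Fin n => Even (v : ℕ)) (X : Fin n → MvPolynomial (Fin n) K)
    (fun v _ => MvPolynomial.X_prime) hl
  simp only [Finset.mem_filter, Finset.mem_univ, true_and] at key
  have h := key 1 one_ne_zero
  rw [pow_one] at h
  rw [indIdeal_eq_span_prod K hn]
  exact ⟨(key k (by omega)).trans h.symm, h⟩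
end

section
/- Let t > 1 and n = 2t be integers, and let k ≥ 1. Then Ass(I^k) = Ass(I) = {⟨x_{i_1}, x_{i_2}⟩ : 1 ≤ i_1 < i_2 ≤ 2t, i_1 is odd and i_2 is even}; that is, the associated prime ideals of I^k are exactly the ideals generated by two variables x_{i_1}, x_{i_2} with i_1 < i_2, i_1 odd and i_2 even. In particular I is normally torsion-free. -/
open MvPolynomial

section PairOrder

variable {σ K : Type*} [Field K]

open Classical in
/-- The order of vanishing of a polynomial along the linear subspace `X v = X w = 0`. -/
noncomputable def pairOrder (v w : σ) (f : MvPolynomial σ K) : ℕ∞ :=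
  MvPowerSeries.weightedOrder (fun i ↦ if i = v ∨ i = w then 1 else 0) (f : MvPowerSeries σ K)

open Classical in
theorem weight_pair {v w : σ} (hvw : v ≠ w) (d : σ →₀ ℕ) :
    Finsupp.weight (fun i ↦ if i = v ∨ i = w then 1 else 0) d = d v + d w := by
  have h : (fun i ↦ if i = v ∨ i = w then 1 else 0 : σ → ℕ) = Pi.single v 1 + Pi.single w 1 := by
    funext i
    simp only [Pi.add_apply, Pi.single_apply]
    grind
  rw [h, ← Finsupp.weight_single_one_apply v d, ← Finsupp.weight_single_one_apply w d]
  simp [Finsupp.weight_apply, mul_add, Finsupp.sum_add]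

theorem le_pairOrder_iff {v w : σ} (hvw : v ≠ w) (f : MvPolynomial σ K) (m : ℕ) :
    (m : ℕ∞) ≤ pairOrder v w f ↔ ∀ d ∈ f.support, m ≤ d v + d w := by
  classical
  constructor
  · intro h d hd
    rw [← weight_pair hvw, ← Nat.cast_le (α := ℕ∞)]
    refine h.trans (MvPowerSeries.weightedOrder_le _ ?_)
    simpa using mem_support_iff.1 hd
  · intro h
    refine MvPowerSeries.le_weightedOrder _ fun d hd ↦ ?_
    rw [weight_pair hvw, Nat.cast_lt] at hd
    by_contra hne
    exact absurd (h d (mem_support_iff.2 (by simpa using hne))) (by omega)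

theorem pairOrder_mul (v w : σ) (f g : MvPolynomial σ K) :
    pairOrder v w (f * g) = pairOrder v w f + pairOrder v w g := by
  simp [pairOrder, MvPowerSeries.weightedOrder_mul]

theorem pairOrder_one (v w : σ) : pairOrder v w (1 : MvPolynomial σ K) = 0 := by
  simp [pairOrder, MvPowerSeries.weightedOrder_one]

theorem pairOrder_pow (v w : σ) (f : MvPolynomial σ K) (m : ℕ) :
    pairOrder v w (f ^ m) = m * pairOrder v w f := by
  induction m with
  | zero => simp [pairOrder_one]
  | succ m ih => rw [pow_succ, pairOrder_mul, ih]; push_cast; ring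

theorem pairOrder_monomial {v w : σ} (hvw : v ≠ w) (d : σ →₀ ℕ) :
    pairOrder v w (monomial d (1 : K)) = (d v + d w : ℕ) := by
  classical
  rw [pairOrder, coe_monomial, MvPowerSeries.weightedOrder_monomial_of_ne_zero _ one_ne_zero,
    weight_pair hvw]

/-- The polynomials vanishing to order at least `m` along `X v = X w = 0`. -/
def pairOrderIdeal {v w : σ} (hvw : v ≠ w) (m : ℕ) : Ideal (MvPolynomial σ K) where
  carrier := {f | (m : ℕ∞) ≤ pairOrder v w f}
  add_mem' {f g} hf hg := by
    classical
    simp only [Set.mem_ofPred_eq, le_pairOrder_iff hvw] at *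
    intro d hd
    rcases Finset.mem_union.1 (support_add hd) with h | h
    exacts [hf d h, hg d h]
  zero_mem' := by simp [le_pairOrder_iff hvw]
  smul_mem' f g hg := by
    simp only [Set.mem_ofPred_eq, smul_eq_mul, pairOrder_mul] at *
    exact hg.trans le_add_self

theorem mem_pairOrderIdeal {v w : σ} (hvw : v ≠ w) (m : ℕ) (f : MvPolynomial σ K) :
    f ∈ pairOrderIdeal hvw m ↔ (m : ℕ∞) ≤ pairOrder v w f := Iff.rfl

theorem pow_le_pairOrderIdeal {v w : σ} (hvw : v ≠ w) {I : Ideal (MvPolynomial σ K)}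
    (hI : I ≤ pairOrderIdeal hvw 1) (k : ℕ) : I ^ k ≤ pairOrderIdeal hvw k := by
  induction k with
  | zero => intro f _; simp [mem_pairOrderIdeal]
  | succ k ih =>
    rw [pow_succ, Ideal.mul_le]
    intro f hf g hg
    rw [mem_pairOrderIdeal, pairOrder_mul, Nat.cast_add]
    exact add_le_add (ih hf) (hI hg)

theorem mem_span_pair_X_iff {v w : σ} (hvw : v ≠ w) (f : MvPolynomial σ K) :
    f ∈ Ideal.span {X v, X w} ↔ 1 ≤ pairOrder v w f := by
  have h := le_pairOrder_iff hvw f 1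
  rw [Nat.cast_one] at h
  rw [h, ← Set.image_pair, mem_ideal_span_X_image]
  refine forall₂_congr fun d _ ↦ ?_
  simp only [Set.mem_insert_iff, Set.mem_singleton_iff, exists_eq_or_imp, exists_eq_left]
  omega

theorem isPrime_span_pair_X {v w : σ} (hvw : v ≠ w) :
    (Ideal.span {X v, X w} : Ideal (MvPolynomial σ K)).IsPrime := by
  refine Ideal.isPrime_iff.2 ⟨fun h ↦ ?_, fun {f g} h ↦ ?_⟩
  · simpa [mem_span_pair_X_iff hvw, pairOrder_one] using (Ideal.eq_top_iff_one _).1 h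
  · simp only [mem_span_pair_X_iff hvw, pairOrder_mul, Order.one_le_iff_ne_zero] at *
    simpa [← not_and_or] using h

theorem exists_le_pairOrder_pow_mul_iff {ι : Type*} {v w : ι → σ}
    (f h : MvPolynomial σ K) (k : ℕ) :
    (∃ m : ℕ, ∀ i, (k : ℕ∞) ≤ pairOrder (v i) (w i) (h ^ m * f)) ↔
      ∀ i, (k : ℕ∞) ≤ pairOrder (v i) (w i) f ∨ 1 ≤ pairOrder (v i) (w i) h := by
  simp only [pairOrder_mul, pairOrder_pow]
  constructor
  · rintro ⟨m, hm⟩ i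
    by_contra! hcon
    have := hm i
    rw [Order.lt_one_iff.1 hcon.2, mul_zero, zero_add] at this
    exact absurd this (not_le.2 hcon.1)
  · refine fun H ↦ ⟨k, fun i ↦ (H i).elim (fun hf ↦ hf.trans le_add_self) fun hh ↦ ?_⟩
    calc (k : ℕ∞) = k * 1 := (mul_one _).symm
      _ ≤ k * pairOrder (v i) (w i) h := by gcongr
      _ ≤ _ := le_self_add

theorem mem_associatedPrimes_quotient_iff {R : Type*} [CommRing R] (J Q : Ideal R) :
    Q ∈ associatedPrimes R (R ⧸ J) ↔
      Q.IsPrime ∧ ∃ f, ∀ h, h ∈ Q ↔ ∃ m : ℕ, h ^ m * f ∈ J := by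
  have key (f h : R) : h ∈ (Submodule.colon (⊥ : Submodule R (R ⧸ J))
      {Ideal.Quotient.mk J f}).radical ↔ ∃ m : ℕ, h ^ m * f ∈ J := by
    simp only [Ideal.mem_radical_iff, Submodule.mem_colon_singleton, Submodule.mem_bot]
    refine exists_congr fun m ↦ ?_
    rw [← Ideal.Quotient.eq_zero_iff_mem, map_mul, Algebra.smul_def, Ideal.Quotient.algebraMap_eq]
  constructor
  · rintro ⟨hQ, x, rfl⟩
    obtain ⟨f, rfl⟩ := Ideal.Quotient.mk_surjective x
    exact ⟨hQ, f, key f⟩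
  · rintro ⟨hQ, f, hf⟩
    exact ⟨hQ, Ideal.Quotient.mk J f, Ideal.ext fun h ↦ (hf h).trans (key f h).symm⟩

/-- If `J` consists of the polynomials vanishing to order at least `k` along finitely many
codimension two coordinate subspaces, none of which contains another, then the associated primes
of `J` are the ideals of these subspaces. -/
theorem associatedPrimes_of_mem_iff_pairOrder [Finite σ] {ι : Type*} [Finite ι] {v w : ι → σ}
    (hvw : ∀ i, v i ≠ w i)
    (hinj : ∀ i j, (v j = v i ∨ v j = w i) → (w j = v i ∨ w j = w i) → j = i)
    {k : ℕ} (hk : 1 ≤ k) {J : Ideal (MvPolynomial σ K)}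
    (hJ : ∀ f, f ∈ J ↔ ∀ i, (k : ℕ∞) ≤ pairOrder (v i) (w i) f) :
    associatedPrimes (MvPolynomial σ K) (MvPolynomial σ K ⧸ J) =
      Set.range fun i ↦ Ideal.span {X (v i), X (w i)} := by
  classical
  have := Fintype.ofFinite ι
  ext Q
  simp only [mem_associatedPrimes_quotient_iff, hJ, exists_le_pairOrder_pow_mul_iff, Set.mem_range]
  constructor
  · rintro ⟨hQ, f, hf⟩
    let s : Finset ι := Finset.univ.filter fun i ↦ ¬ (k : ℕ∞) ≤ pairOrder (v i) (w i) f
    have hs : Q = s.inf fun i ↦ Ideal.span {X (v i), X (w i)} := by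
      ext h
      simp only [hf, Submodule.mem_finsetInf, mem_span_pair_X_iff (hvw _), s, Finset.mem_filter,
        Finset.mem_univ, true_and]
      exact forall_congr' fun i ↦ or_iff_not_imp_left
    rw [hs] at hQ ⊢
    obtain ⟨i, -, hi⟩ := Ideal.eq_inf_of_isPrime_inf hQ
    exact ⟨i, hi⟩
  · rintro ⟨i, rfl⟩
    let d : σ →₀ ℕ := Finsupp.equivFunOnFinite.symm fun x ↦ if x = v i ∨ x = w i then 0 else k
    refine ⟨isPrime_span_pair_X (hvw i), monomial d 1, fun h ↦ ?_⟩
    simp only [mem_span_pair_X_iff (hvw _), pairOrder_monomial (hvw _), Nat.cast_le]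
    refine ⟨fun hi j ↦ ?_, fun H ↦ (H i).resolve_left ?_⟩
    · by_cases hj : j = i
      · exact Or.inr (hj ▸ hi)
      · refine Or.inl ?_
        have := hinj i j
        simp only [d, Finsupp.coe_equivFunOnFinite_symm]
        grind
    · simp only [d, Finsupp.coe_equivFunOnFinite_symm]
      simp
      omega

end PairOrder

section IndependentSets

theorem IsIndepSet.mem_or_mem {t : ℕ} {F : Finset (Fin (2 * t))} (hF : IsIndepSet (2 * t) F)
    (hcard : F.card = t) {v w : Fin (2 * t)} (hvw : v < w) (hv : Even (v : ℕ))
    (hw : Odd (w : ℕ)) : v ∈ F ∨ w ∈ F := by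
  have himage : F.image (fun i : Fin (2 * t) ↦ (i : ℕ) / 2) = Finset.range t := by
    refine Finset.eq_of_subset_of_card_le (fun p hp ↦ ?_) ?_
    · obtain ⟨i, -, rfl⟩ := Finset.mem_image.1 hp
      rw [Finset.mem_range]
      omega
    · rw [Finset.card_image_of_injOn, hcard, Finset.card_range]
      intro i hi j hj hij
      have h₁ := hF i hi j hj
      have h₂ := hF j hj i hi
      ext
      simp only at hij
      omega
  have hpair (p : ℕ) (hp : p < t) : ∃ i ∈ F, (i : ℕ) / 2 = p := by
    rwa [← Finset.mem_range, ← himage, Finset.mem_image] at hp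
  obtain ⟨p, hp⟩ := hv
  obtain ⟨q, hq⟩ := hw
  rw [or_iff_not_imp_left]
  intro hvF
  have hodd (r : ℕ) (hpr : p ≤ r) : r ≤ q → ∃ i ∈ F, (i : ℕ) = 2 * r + 1 := by
    induction r, hpr using Nat.le_induction with
    | base =>
      intro _
      obtain ⟨i, hi, hip⟩ := hpair p (by omega)
      refine ⟨i, hi, ?_⟩
      by_contra hne
      exact hvF ((Fin.ext (by omega) : i = v) ▸ hi)
    | succ r hpr ih =>
      intro hr
      obtain ⟨j, hj, hjr⟩ := ih (by omega)
      obtain ⟨i, hi, hir⟩ := hpair (r + 1) (by omega)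
      have := hF j hj i hi
      exact ⟨i, hi, by omega⟩
  obtain ⟨i, hi, hiq⟩ := hodd q (by omega) le_rfl
  exact (Fin.ext (by omega) : i = w) ▸ hi

/-- The independent set `x_1, x_3, …, x_{2j-1}, x_{2j+2}, …, x_{2t}` of the path on `2t`
vertices. -/
def switchSet (t j : ℕ) : Finset (Fin (2 * t)) :=
  Finset.univ.image fun p : Fin t ↦
    if (p : ℕ) < j then ⟨2 * p, by omega⟩ else ⟨2 * p + 1, by omega⟩

theorem mem_switchSet {t j : ℕ} (i : Fin (2 * t)) :
    i ∈ switchSet t j ↔ if (i : ℕ) < 2 * j then Even (i : ℕ) else Odd (i : ℕ) := by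
  simp only [switchSet, Finset.mem_image, Finset.mem_univ, true_and, Nat.even_iff, Nat.odd_iff]
  constructor
  · rintro ⟨p, rfl⟩
    split_ifs <;> simp_all <;> omega
  · intro h
    refine ⟨⟨i / 2, by omega⟩, ?_⟩
    ext
    split_ifs at h ⊢ <;> (simp_all; omega)

theorem isIndepSet_switchSet (t j : ℕ) : IsIndepSet (2 * t) (switchSet t j) := by
  intro a ha b hb
  simp only [mem_switchSet, Nat.even_iff, Nat.odd_iff] at ha hb
  split_ifs at ha hb <;> omega

theorem card_switchSet (t j : ℕ) : (switchSet t j).card = t := by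
  rw [switchSet, Finset.card_image_of_injective, Finset.card_univ, Fintype.card_fin]
  intro p q h
  ext
  have := congrArg Fin.val h
  simp only at this
  split_ifs at this <;> simp only at this <;> omega

end IndependentSets

section PowersOfIndIdeal

variable {K : Type*} [Field K] {t : ℕ}

theorem indIdeal_le_pairOrderIdeal {v w : Fin (2 * t)} (hvw : v < w) (hv : Even (v : ℕ))
    (hw : Odd (w : ℕ)) : indIdeal K (2 * t) t ≤ pairOrderIdeal hvw.ne 1 := by
  refine Ideal.span_le.2 ?_
  rintro _ ⟨F, hF, hcard, rfl⟩
  have hmem : ∏ i ∈ F, X i ∈ (Ideal.span {X v, X w} : Ideal (MvPolynomial (Fin (2 * t)) K)) := by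
    rcases hF.mem_or_mem hcard hvw hv hw with h | h <;>
      exact Ideal.mem_of_dvd _ (Finset.dvd_prod_of_mem X h) (Ideal.subset_span (by simp))
  simpa [mem_pairOrderIdeal] using (mem_span_pair_X_iff hvw.ne _).1 hmem

theorem monomial_mem_indIdeal_pow (k : ℕ) (d : Fin (2 * t) →₀ ℕ)
    (hd : ∀ v w : Fin (2 * t), v < w → Even (v : ℕ) → Odd (w : ℕ) → k ≤ d v + d w) :
    monomial d (1 : K) ∈ indIdeal K (2 * t) t ^ k := by
  classical
  induction k generalizing d with
  | zero => simp
  | succ k ih =>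
    have hex : ∃ j, j = t ∨ ∃ v : Fin (2 * t), (v : ℕ) = 2 * j ∧ d v = 0 := ⟨t, Or.inl rfl⟩
    obtain ⟨j, hj, hmin⟩ : ∃ j, (j = t ∨ ∃ v : Fin (2 * t), (v : ℕ) = 2 * j ∧ d v = 0) ∧
        ∀ v : Fin (2 * t), Even (v : ℕ) → (v : ℕ) < 2 * j → 1 ≤ d v := by
      refine ⟨Nat.find hex, Nat.find_spec hex, fun v ⟨p, hp⟩ hv ↦ ?_⟩
      have := Nat.find_min hex (m := p) (by omega)
      push Not at this
      exact Nat.one_le_iff_ne_zero.2 (this.2 v (by omega))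
    have hpos (w : Fin (2 * t)) (hw : Odd (w : ℕ)) (hjw : 2 * j ≤ (w : ℕ)) : k + 1 ≤ d w := by
      rcases hj with rfl | ⟨v, hv, hv0⟩
      · omega
      · have := hd v w (by rw [Fin.lt_def]; rw [Nat.odd_iff] at hw; omega) (by simp [hv]) hw
        omega
    set e : Fin (2 * t) →₀ ℕ := ∑ i ∈ switchSet t j, Finsupp.single i 1 with he
    have hei (i : Fin (2 * t)) : e i = if i ∈ switchSet t j then 1 else 0 := by
      simp [he, Finsupp.finsetSum_apply, Finsupp.single_apply]
    have hed : e ≤ d := by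
      intro i
      rw [hei]
      split_ifs with hi
      · rw [mem_switchSet] at hi
        split_ifs at hi with hij
        · exact hmin i hi hij
        · have := hpos i hi (by omega)
          omega
      · exact Nat.zero_le _
    rw [← tsub_add_cancel_of_le hed, ← mul_one (1 : K), ← monomial_mul, pow_succ]
    refine Ideal.mul_mem_mul (ih _ fun v w hvw hv hw ↦ ?_) ?_
    · have h₁ := hd v w hvw hv hw
      have h₂ := hmin v hv
      have h₃ := hpos w hw
      have hvj : v ∈ switchSet t j ↔ (v : ℕ) < 2 * j := by
        simp [mem_switchSet, hv, Nat.not_odd_iff_even.2 hv]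
      have hwj : w ∈ switchSet t j ↔ 2 * j ≤ (w : ℕ) := by
        simp [mem_switchSet, hw, Nat.not_even_iff_odd.2 hw]
      simp only [Finsupp.coe_tsub, Pi.sub_apply, hei, hvj, hwj]
      have hvw' : (v : ℕ) < w := hvw
      split_ifs <;> omega
    · rw [he, monomial_sum_one]
      exact Ideal.subset_span ⟨_, isIndepSet_switchSet t j, card_switchSet t j, rfl⟩

/-- The ordinary powers of `indIdeal K (2 * t) t` coincide with its symbolic powers. -/
theorem mem_indIdeal_pow_iff (k : ℕ) (f : MvPolynomial (Fin (2 * t)) K) :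
    f ∈ indIdeal K (2 * t) t ^ k ↔ ∀ v w : Fin (2 * t), v < w → Even (v : ℕ) → Odd (w : ℕ) →
      (k : ℕ∞) ≤ pairOrder v w f := by
  refine ⟨fun hf v w hvw hv hw ↦
    pow_le_pairOrderIdeal hvw.ne (indIdeal_le_pairOrderIdeal hvw hv hw) k hf, fun h ↦ ?_⟩
  rw [f.as_sum]
  refine Ideal.sum_mem _ fun d hd ↦ ?_
  rw [← mul_one (f.coeff d), ← C_mul_monomial]
  refine Ideal.mul_mem_left _ _ (monomial_mem_indIdeal_pow k d fun v w hvw hv hw ↦ ?_)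
  exact (le_pairOrder_iff hvw.ne f k).1 (h v w hvw hv hw) d hd

theorem associatedPrimes_indIdeal_pow {k : ℕ} (hk : 1 ≤ k) :
    associatedPrimes (MvPolynomial (Fin (2 * t)) K)
        (MvPolynomial (Fin (2 * t)) K ⧸ indIdeal K (2 * t) t ^ k) =
      {P | ∃ v w : Fin (2 * t), v < w ∧ Even (v : ℕ) ∧ Odd (w : ℕ) ∧
        P = Ideal.span {X v, X w}} := by
  let ι := {p : Fin (2 * t) × Fin (2 * t) // p.1 < p.2 ∧ Even (p.1 : ℕ) ∧ Odd (p.2 : ℕ)}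
  rw [associatedPrimes_of_mem_iff_pairOrder (ι := ι) (v := fun i ↦ i.1.1) (w := fun i ↦ i.1.2)
    (fun i ↦ i.2.1.ne) ?_ hk]
  · ext P
    simp only [Set.mem_range, Set.mem_ofPred_eq, ι, Subtype.exists, Prod.exists, exists_prop,
      and_assoc, eq_comm]
  · intro f
    simp only [mem_indIdeal_pow_iff, ι, Subtype.forall, Prod.forall, and_imp]
  · rintro ⟨⟨v, w⟩, h, hv, hw⟩ ⟨⟨v', w'⟩, h', hv', hw'⟩ h₁ h₂
    rw [Subtype.mk.injEq, Prod.mk.injEq]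
    simp only [Nat.even_iff, Nat.odd_iff, Fin.ext_iff] at hv hw hv' hw' h₁ h₂ ⊢
    omega

end PowersOfIndIdeal

/-- If `n = 2t` then for every `k ≥ 1`,
`Ass(Iᵏ) = Ass(I) = {⟨x_{i₁}, x_{i₂}⟩ : i₁ < i₂, i₁ odd, i₂ even}`;
in particular `I` is normally torsion-free.  In 0-based indexing `v = i - 1`,
"`i₁` odd" becomes `Even (v₁ : ℕ)` and "`i₂` even" becomes `Odd (v₂ : ℕ)`. -/
theorem stmt1 (K : Type*) [Field K] (t n k : ℕ) (ht : 1 < t) (hn : n = 2 * t)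
    (hk : 1 ≤ k) :
    associatedPrimes (MvPolynomial (Fin n) K)
        (MvPolynomial (Fin n) K ⧸ (indIdeal K n t) ^ k) =
      associatedPrimes (MvPolynomial (Fin n) K)
        (MvPolynomial (Fin n) K ⧸ indIdeal K n t) ∧
    associatedPrimes (MvPolynomial (Fin n) K)
        (MvPolynomial (Fin n) K ⧸ indIdeal K n t) =
      {P | ∃ v₁ v₂ : Fin n, v₁ < v₂ ∧ Even (v₁ : ℕ) ∧ Odd (v₂ : ℕ) ∧
        P = Ideal.span {X v₁, X v₂}} := by
  subst hn
  rw [associatedPrimes_indIdeal_pow hk, ← associatedPrimes_indIdeal_pow le_rfl, pow_one]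
  exact ⟨rfl, rfl⟩
end

section
/- Let t > 1 and n > 2t be integers, and let k ≥ 1. Then every ideal ⟨x_{i_1}, x_{i_2}, …, x_{i_{n-2t+2ℓ}}⟩, where 1 ≤ ℓ ≤ min{t, k}, 1 ≤ i_1 < i_2 < ⋯ < i_{n-2t+2ℓ} ≤ n, and i_j and j have the same parity for every 1 ≤ j ≤ n-2t+2ℓ, is an associated prime ideal of I^k. -/
open MvPolynomial

/-- The number of values of `e` that are smaller than `a`. -/
def below {m n : ℕ} (e : Fin m → Fin n) (a : ℕ) : ℕ :=
  (Finset.univ.filter fun j => (e j : ℕ) < a).card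

lemma below_apply {m n : ℕ} {e : Fin m → Fin n} (he : StrictMono e) (j : Fin m) :
    below e (e j) = j := by
  have : (Finset.univ.filter fun i => (e i : ℕ) < e j) = Finset.Iio j := by
    ext i
    simp [he.lt_iff_lt]
  rw [below, this, Fin.card_Iio]

lemma below_apply_add_one {m n : ℕ} {e : Fin m → Fin n} (he : StrictMono e) (j : Fin m) :
    below e (e j + 1) = j + 1 := by
  have : (Finset.univ.filter fun i => (e i : ℕ) < e j + 1) = Finset.Iic j := by
    ext i
    simp [he.le_iff_le]
  rw [below, this, Fin.card_Iic]

lemma below_add_one {m n : ℕ} {e : Fin m → Fin n} {a : ℕ} (ha : ∀ j, (e j : ℕ) ≠ a) :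
    below e (a + 1) = below e a := by
  unfold below
  congr 1
  ext j
  have := ha j
  simp
  omega

lemma below_eq_of_le {m n : ℕ} (e : Fin m → Fin n) {a : ℕ} (ha : n ≤ a) : below e a = m := by
  have : (Finset.univ.filter fun j => (e j : ℕ) < a) = Finset.univ := by
    ext j
    have := (e j).isLt
    simp
    omega
  rw [below, this, Finset.card_fin]

lemma below_zero {m n : ℕ} (e : Fin m → Fin n) : below e 0 = 0 := by
  simp [below]

/-- When `e j` and `j` always have the same parity, the complement of the range of `e` is
perfectly matched by edges of the path, and each edge lies in a single gap. -/
lemma exists_gap_matching {m n : ℕ} {e : Fin m → Fin n} (he : StrictMono e)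
    (hpar : ∀ j, (e j : ℕ) % 2 = (j : ℕ) % 2) (hmn : m % 2 = n % 2) :
    ∃ σ : Fin n → Fin n, ∀ v, (∀ j, e j ≠ v) →
      (∀ j, e j ≠ σ v) ∧ below e (σ v) = below e v ∧ σ (σ v) = v ∧
      ((σ v : ℕ) = v + 1 ∨ (σ v : ℕ) + 1 = v) := by
  have key : ∀ v : Fin n, ∃ w : Fin n, (∀ j, e j ≠ v) →
      (∀ j, e j ≠ w) ∧ below e w = below e v ∧
      (((v : ℕ) % 2 = below e v % 2 ∧ (w : ℕ) = v + 1) ∨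
        ((v : ℕ) % 2 ≠ below e v % 2 ∧ (w : ℕ) + 1 = v)) := by
    intro v
    by_cases hv : ∀ j, e j ≠ v
    swap
    · exact ⟨v, fun h => absurd h hv⟩
    have hv' : ∀ j, (e j : ℕ) ≠ v := fun j h => hv j (Fin.ext h)
    have hs := below_add_one hv'
    by_cases hp : (v : ℕ) % 2 = below e v % 2
    · have hlt : (v : ℕ) + 1 < n := by
        by_contra hge
        have := below_eq_of_le e (not_lt.mp hge)
        have := v.isLt
        omega
      refine ⟨⟨v + 1, hlt⟩, fun _ => ⟨fun j hj => ?_, hs, Or.inl ⟨hp, rfl⟩⟩⟩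
      have h1 : (e j : ℕ) = v + 1 := congrArg Fin.val hj
      have h2 := below_apply he j
      have h3 := hpar j
      rw [h1, hs] at h2
      omega
    · obtain ⟨a, ha⟩ : ∃ a, (v : ℕ) = a + 1 := by
        refine Nat.exists_eq_succ_of_ne_zero fun h0 => ?_
        rw [h0, below_zero] at hp
        exact hp rfl
      have hne : ∀ j, (e j : ℕ) ≠ a := by
        intro j hj
        have h2 := below_apply_add_one he j
        have h3 := hpar j
        rw [hj, ← ha] at h2
        omega
      refine ⟨⟨a, by omega⟩, fun _ => ⟨fun j hj => hne j (congrArg Fin.val hj), ?_,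
        Or.inr ⟨hp, ha.symm⟩⟩⟩
      rw [ha, below_add_one hne]
  choose σ hσ using key
  refine ⟨σ, fun v hv => ?_⟩
  obtain ⟨h1, h2, h3⟩ := hσ v hv
  obtain ⟨-, -, h4⟩ := hσ _ h1
  refine ⟨h1, h2, Fin.ext ?_, by omega⟩
  rw [h2] at h4
  omega

lemma card_filter_forall_ne {m n : ℕ} {e : Fin m → Fin n} (he : Function.Injective e) :
    (Finset.univ.filter fun v => ∀ j, e j ≠ v).card = n - m := by
  have : (Finset.univ.filter fun v => ∀ j, e j ≠ v) = (Finset.univ.image e)ᶜ := by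
    ext v
    simp
  rw [this, Finset.card_compl, Finset.card_image_of_injective _ he]
  simp

/-- An independent set contains at most half of the complement of the range of `e`. -/
lemma two_mul_card_filter_le {m n : ℕ} {e : Fin m → Fin n} (he : StrictMono e)
    (hpar : ∀ j, (e j : ℕ) % 2 = (j : ℕ) % 2) (hmn : m % 2 = n % 2)
    {F : Finset (Fin n)} (hF : IsIndepSet n F) :
    2 * (F.filter fun v => ∀ j, e j ≠ v).card ≤ n - m := by
  classical
  obtain ⟨σ, hσ⟩ := exists_gap_matching he hpar hmn
  set B := F.filter fun v => ∀ j, e j ≠ v with hB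
  have hinj : Set.InjOn σ B := by
    intro v hv w hw h
    have hv := (Finset.mem_filter.mp hv).2
    have hw := (Finset.mem_filter.mp hw).2
    rw [← (hσ v hv).2.2.1, h, (hσ w hw).2.2.1]
  have hdisj : Disjoint B (B.image σ) := by
    rw [Finset.disjoint_left]
    intro v hv hv'
    obtain ⟨w, hw, rfl⟩ := Finset.mem_image.mp hv'
    have hwF := Finset.mem_filter.mp hw
    have hvF := Finset.mem_filter.mp hv
    rcases (hσ w hwF.2).2.2.2 with h | h
    · exact hF _ hwF.1 _ hvF.1 h.symm
    · exact hF _ hvF.1 _ hwF.1 h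
  rw [← card_filter_forall_ne he.injective, two_mul]
  nth_rewrite 2 [← Finset.card_image_of_injOn hinj]
  rw [← Finset.card_union_of_disjoint hdisj]
  refine Finset.card_le_card fun v hv => ?_
  rw [Finset.mem_filter]
  refine ⟨Finset.mem_univ _, ?_⟩
  rcases Finset.mem_union.mp hv with h | h
  · exact (Finset.mem_filter.mp h).2
  · obtain ⟨w, hw, rfl⟩ := Finset.mem_image.mp h
    exact (hσ w (Finset.mem_filter.mp hw).2).1

/-- An independent set of the contracted path lifts to an independent set of `Pₙ` by adding
half of the complement of the range of `e`. -/
lemma exists_isIndepSet_lift {m n : ℕ} {e : Fin m → Fin n} (he : StrictMono e)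
    (hpar : ∀ j, (e j : ℕ) % 2 = (j : ℕ) % 2) (hmn : m % 2 = n % 2)
    {G : Finset (Fin m)} (hG : IsIndepSet m G) :
    ∃ B : Finset (Fin n), (∀ v ∈ B, ∀ j, e j ≠ v) ∧ 2 * B.card = n - m ∧
      IsIndepSet n (G.image e ∪ B) := by
  classical
  obtain ⟨σ, hσ⟩ := exists_gap_matching he hpar hmn
  set C := Finset.univ.filter fun v => ∀ j, e j ≠ v with hC
  set q : Fin n → Prop := fun v =>
    ((v : ℕ) % 2 = below e v % 2 ↔ ∃ j ∈ G, (j : ℕ) = below e v) with hq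
  have hqσ : ∀ v ∈ C, (q (σ v) ↔ ¬ q v) := by
    intro v hv
    obtain ⟨-, h2, -, h4⟩ := hσ v (Finset.mem_filter.mp hv).2
    have : (σ v : ℕ) % 2 = below e v % 2 ↔ ¬ (v : ℕ) % 2 = below e v % 2 := by omega
    simp only [hq, h2, this]
    exact not_iff.symm
  have hσC : ∀ v ∈ C, σ v ∈ C := fun v hv =>
    Finset.mem_filter.mpr ⟨Finset.mem_univ _, (hσ v (Finset.mem_filter.mp hv).2).1⟩
  have hσσ : ∀ v ∈ C, σ (σ v) = v := fun v hv => (hσ v (Finset.mem_filter.mp hv).2).2.2.1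
  have hcard : (C.filter q).card = (C.filter fun v => ¬ q v).card := by
    refine Finset.card_nbij' σ σ ?_ ?_ ?_ ?_
    · intro v hv
      have hv := Finset.mem_filter.mp hv
      exact Finset.mem_filter.mpr ⟨hσC v hv.1, fun h => (hqσ v hv.1).mp h hv.2⟩
    · intro v hv
      have hv := Finset.mem_filter.mp hv
      exact Finset.mem_filter.mpr ⟨hσC v hv.1, (hqσ v hv.1).mpr hv.2⟩
    · exact fun v hv => hσσ v (Finset.mem_filter.mp hv).1
    · exact fun v hv => hσσ v (Finset.mem_filter.mp hv).1
  have hsum := Finset.card_filter_add_card_filter_not (s := C) q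
  rw [hC, card_filter_forall_ne he.injective, ← hC] at hsum
  refine ⟨C.filter q, fun v hv => ?_, by omega, ?_⟩
  · exact (Finset.mem_filter.mp (Finset.mem_filter.mp hv).1).2
  intro v hv w hw hvw
  rcases Finset.mem_union.mp hv with hv | hv <;> rcases Finset.mem_union.mp hw with hw | hw
  · obtain ⟨i, hi, rfl⟩ := Finset.mem_image.mp hv
    obtain ⟨j, hj, rfl⟩ := Finset.mem_image.mp hw
    have h1 := below_apply_add_one he i
    rw [hvw, below_apply he j] at h1
    exact hG i hi j hj h1.symm
  · obtain ⟨i, hi, rfl⟩ := Finset.mem_image.mp hv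
    obtain ⟨-, hw⟩ := Finset.mem_filter.mp hw
    have h1 := below_apply_add_one he i
    have h2 := hpar i
    rw [hvw] at h1
    obtain ⟨j, hj, hj'⟩ := hw.mp (by omega)
    exact hG i hi j hj (by omega)
  · obtain ⟨j, hj, rfl⟩ := Finset.mem_image.mp hw
    obtain ⟨hvC, hv⟩ := Finset.mem_filter.mp hv
    have hvC := (Finset.mem_filter.mp hvC).2
    have h1 := below_add_one (e := e) (a := v) fun j h => hvC j (Fin.ext h)
    rw [hvw, below_apply he j] at h1
    have h2 := hv.mpr ⟨j, hj, h1⟩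
    have h3 := hpar j
    omega
  · obtain ⟨hvC, hv⟩ := Finset.mem_filter.mp hv
    obtain ⟨-, hw⟩ := Finset.mem_filter.mp hw
    have hvC := (Finset.mem_filter.mp hvC).2
    have h1 := below_add_one (e := e) (a := v) fun j h => hvC j (Fin.ext h)
    rw [hvw] at h1
    simp only [hq, h1] at hv hw
    have : (w : ℕ) % 2 = below e v % 2 ↔ ¬ (v : ℕ) % 2 = below e v % 2 := by omega
    exact iff_not_self (hv.trans (hw.symm.trans this))

lemma prod_X_mem_indIdeal (K : Type*) [Field K] {n t : ℕ} {F : Finset (Fin n)}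
    (hF : IsIndepSet n F) (ht : F.card = t) : ∏ v ∈ F, X v ∈ indIdeal K n t :=
  Ideal.subset_span ⟨F, hF, ht, rfl⟩

lemma IsIndepSet.mono {n : ℕ} {F G : Finset (Fin n)} (hG : IsIndepSet n G) (h : F ⊆ G) :
    IsIndepSet n F :=
  fun i hi j hj => hG i (h hi) j (h hj)

lemma X_mul_prod_pow_mem (K : Type*) [Field K] {m d : ℕ} {A D : Finset (Fin m)} {i : Fin m}
    (hA : IsIndepSet m A) (hAcard : A.card = d + 2) (hDA : D ⊆ A) (hDcard : D.card = d)
    (hi : i ∉ D) (hiD : IsIndepSet m (insert i D)) :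
    X i * (∏ v ∈ A, X v) ^ d ∈ indIdeal K m (d + 1) ^ (d + 1) := by
  have h1 : (∏ v ∈ A, X v : MvPolynomial (Fin m) K) ^ d =
      (∏ b ∈ D, ∏ v ∈ A.erase b, X v) * ∏ b ∈ D, X b := by
    rw [← Finset.prod_mul_distrib, ← hDcard, ← Finset.prod_const]
    exact Finset.prod_congr rfl fun b hb => (Finset.prod_erase_mul _ _ (hDA hb)).symm
  have h2 : ∏ b ∈ D, ∏ v ∈ A.erase b, (X v : MvPolynomial (Fin m) K) ∈
      indIdeal K m (d + 1) ^ d := by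
    rw [← hDcard, ← Finset.prod_const]
    refine Ideal.prod_mem_prod fun b hb =>
      prod_X_mem_indIdeal K (hA.mono (Finset.erase_subset _ _)) ?_
    rw [Finset.card_erase_of_mem (hDA hb)]
    omega
  have h3 : ∏ v ∈ insert i D, (X v : MvPolynomial (Fin m) K) ∈ indIdeal K m (d + 1) :=
    prod_X_mem_indIdeal K hiD (by rw [Finset.card_insert_of_notMem hi, hDcard])
  rw [Finset.prod_insert hi] at h3
  rw [h1, pow_succ]
  convert Ideal.mul_mem_mul h2 h3 using 1
  ring

/-- The independent set formed by the first `d + 2` vertices at even distance from the end. -/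
lemma exists_isIndepSet_card {m d : ℕ} (hm : 2 * (d + 1) < m) :
    ∃ A : Finset (Fin m), IsIndepSet m A ∧ A.card = d + 2 ∧
      ∀ i, ∃ D ⊆ A, D.card = d ∧ i ∉ D ∧ IsIndepSet m (insert i D) := by
  classical
  set f : Fin (d + 2) → Fin m := fun a => ⟨2 * a, by omega⟩ with hf
  have hinj : Function.Injective f := by
    intro a b h
    have := congrArg Fin.val h
    simp only [hf] at this
    exact Fin.ext (by omega)
  refine ⟨Finset.univ.image f, ?_, ?_, fun i => ?_⟩
  · intro x hx y hy
    obtain ⟨a, -, rfl⟩ := Finset.mem_image.mp hx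
    obtain ⟨b, -, rfl⟩ := Finset.mem_image.mp hy
    simp only [hf]
    omega
  · rw [Finset.card_image_of_injective _ hinj, Finset.card_fin]
  · set N : Finset (Fin (d + 2)) :=
      Finset.univ.filter fun a => (a : ℕ) ∉ ({(i : ℕ) / 2, ((i : ℕ) + 1) / 2} : Finset ℕ) with hN
    have hcard : d ≤ N.card := by
      have h1 := Finset.card_filter_add_card_filter_not (s := (Finset.univ : Finset (Fin (d + 2))))
        fun a => (a : ℕ) ∈ ({(i : ℕ) / 2, ((i : ℕ) + 1) / 2} : Finset ℕ)
      have h2 : (Finset.univ.filter fun a : Fin (d + 2) =>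
          (a : ℕ) ∈ ({(i : ℕ) / 2, ((i : ℕ) + 1) / 2} : Finset ℕ)).card ≤ 2 :=
        (Finset.card_le_card_of_injOn (Fin.val : Fin (d + 2) → ℕ)
          (fun a ha => (Finset.mem_filter.mp ha).2) Fin.val_injective.injOn).trans
          Finset.card_le_two
      rw [Finset.card_fin] at h1
      have h3 : d ≤ (Finset.univ.filter fun a : Fin (d + 2) =>
          ¬ (a : ℕ) ∈ ({(i : ℕ) / 2, ((i : ℕ) + 1) / 2} : Finset ℕ)).card := by omega
      convert h3
    obtain ⟨D, hDN, hD⟩ := Finset.exists_subset_card_eq hcard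
    have hfar : ∀ x ∈ D.image f, (x : ℕ) % 2 = 0 ∧ (x : ℕ) ≠ i ∧ (x : ℕ) + 1 ≠ i ∧
        (i : ℕ) + 1 ≠ x := by
      intro x hx
      obtain ⟨a, ha, rfl⟩ := Finset.mem_image.mp hx
      have := (Finset.mem_filter.mp (hDN ha)).2
      simp only [Finset.mem_insert, Finset.mem_singleton, not_or] at this
      simp only [hf]
      omega
    refine ⟨D.image f, Finset.image_subset_image (Finset.subset_univ _), ?_, ?_, ?_⟩
    · rw [Finset.card_image_of_injective _ hinj, hD]
    · exact fun h => (hfar i h).2.1 rfl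
    · intro x hx y hy
      rcases Finset.mem_insert.mp hx with hxi | hx <;> rcases Finset.mem_insert.mp hy with hyi | hy
      · omega
      · exact hxi ▸ (hfar y hy).2.2.2
      · exact hyi ▸ (hfar x hx).2.2.1
      · have := hfar x hx
        have := hfar y hy
        omega

/-- Up to a power of the product of the variables outside the range of `e`, the ideal of the
contracted path is contained in the ideal of `Pₙ`. -/
lemma rename_mul_pow_mem (K : Type*) [Field K] {m n s t : ℕ} {e : Fin m → Fin n}
    (he : StrictMono e) (hpar : ∀ j, (e j : ℕ) % 2 = (j : ℕ) % 2) (hmn : m % 2 = n % 2)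
    (hst : n - m + 2 * s = 2 * t) {k : ℕ} {p : MvPolynomial (Fin m) K}
    (hp : p ∈ indIdeal K m s ^ k) :
    rename e p * (∏ v ∈ Finset.univ.filter (fun v => ∀ j, e j ≠ v), X v) ^ k ∈
      indIdeal K n t ^ k := by
  classical
  set c : MvPolynomial (Fin n) K := ∏ v ∈ Finset.univ.filter (fun v => ∀ j, e j ≠ v), X v with hc
  have hle : (indIdeal K m s).map (rename e : MvPolynomial (Fin m) K →ₐ[K] _) * Ideal.span {c} ≤
      indIdeal K n t := by
    rw [indIdeal, Ideal.map_span, Ideal.span_mul_span', Ideal.span_le]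
    rintro _ ⟨_, ⟨_, ⟨G, hG, hGs, rfl⟩, rfl⟩, _, rfl, rfl⟩
    obtain ⟨B, hB, hBcard, hGB⟩ := exists_isIndepSet_lift he hpar hmn hG
    have hdisj : Disjoint (G.image e) B := by
      rw [Finset.disjoint_left]
      intro v hv hvB
      obtain ⟨j, -, rfl⟩ := Finset.mem_image.mp hv
      exact hB _ hvB j rfl
    have h1 := prod_X_mem_indIdeal K (t := t) hGB (by
      rw [Finset.card_union_of_disjoint hdisj, Finset.card_image_of_injective _ he.injective]
      omega)
    rw [Finset.prod_union hdisj, Finset.prod_image he.injective.injOn] at h1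
    have h2 : ∏ v ∈ B, X v ∣ c := Finset.prod_dvd_prod_of_subset _ _ _ fun v hv =>
      Finset.mem_filter.mpr ⟨Finset.mem_univ _, hB v hv⟩
    refine Ideal.mem_of_dvd _ ?_ h1
    simpa [map_prod] using mul_dvd_mul_left _ h2
  refine Ideal.pow_right_mono hle k ?_
  rw [mul_pow, ← Ideal.map_pow]
  exact Ideal.mul_mem_mul (Ideal.mem_map_of_mem _ hp)
    (Ideal.pow_mem_pow (Ideal.mem_span_singleton_self c) k)

/-- Multiplies the variables in `s` by a new variable, which then records the degree in these
variables. -/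
noncomputable def gradeHom (K : Type*) [Field K] {σ : Type*} (s : Set σ) [DecidablePred (· ∈ s)] :
    MvPolynomial σ K →ₐ[K] Polynomial (MvPolynomial σ K) :=
  aeval fun v => if v ∈ s then Polynomial.C (X v) * Polynomial.X else Polynomial.C (X v)

lemma gradeHom_X_of_mem (K : Type*) [Field K] {σ : Type*} {s : Set σ} [DecidablePred (· ∈ s)]
    {v : σ} (hv : v ∈ s) : gradeHom K s (X v) = Polynomial.C (X v) * Polynomial.X := by
  simp [gradeHom, hv]

lemma gradeHom_X_of_notMem (K : Type*) [Field K] {σ : Type*} {s : Set σ} [DecidablePred (· ∈ s)]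
    {v : σ} (hv : v ∉ s) : gradeHom K s (X v) = Polynomial.C (X v) := by
  simp [gradeHom, hv]

lemma mem_span_of_coeff_gradeHom_eq_zero (K : Type*) [Field K] {σ : Type*} {s : Set σ}
    [DecidablePred (· ∈ s)] {f : MvPolynomial σ K} (hf : (gradeHom K s f).coeff 0 = 0) :
    f ∈ Ideal.span (X '' s) := by
  rw [← Ideal.Quotient.eq_zero_iff_mem]
  have h : (Ideal.Quotient.mkₐ K (Ideal.span (X '' s))).comp
      (((Polynomial.aeval (0 : MvPolynomial σ K)).restrictScalars K).comp (gradeHom K s)) =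
      Ideal.Quotient.mkₐ K (Ideal.span (X '' s)) := by
    ext v
    by_cases hv : v ∈ s
    · have : (X v : MvPolynomial σ K) ∈ Ideal.span (X '' s) :=
        Ideal.subset_span (Set.mem_image_of_mem _ hv)
      simp [gradeHom_X_of_mem K hv, Ideal.Quotient.eq_zero_iff_mem.mpr this]
    · simp [gradeHom_X_of_notMem K hv]
  have h' := DFunLike.congr_fun h f
  simpa [← Polynomial.coeff_zero_eq_eval_zero, hf] using h'.symm

lemma isPrime_span_image_X (K : Type*) [Field K] {σ : Type*} (s : Set σ) :
    (Ideal.span ((X : σ → MvPolynomial σ K) '' s)).IsPrime := by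
  classical
  set φ : MvPolynomial σ K →+* MvPolynomial σ K :=
    Polynomial.constantCoeff.comp (gradeHom K s : MvPolynomial σ K →+* _)
  have : Ideal.span ((X : σ → MvPolynomial σ K) '' s) = RingHom.ker φ := by
    refine le_antisymm (Ideal.span_le.mpr ?_) fun f hf => mem_span_of_coeff_gradeHom_eq_zero K hf
    rintro _ ⟨v, hv, rfl⟩
    simp [φ, RingHom.mem_ker, gradeHom_X_of_mem K hv]
  rw [this]
  exact RingHom.ker_isPrime φ

lemma X_pow_dvd_gradeHom (K : Type*) [Field K] {m n s t k : ℕ} {e : Fin m → Fin n}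
    (he : StrictMono e) (hpar : ∀ j, (e j : ℕ) % 2 = (j : ℕ) % 2) (hmn : m % 2 = n % 2)
    (hst : n - m + 2 * s = 2 * t) [DecidablePred (· ∈ Set.range e)]
    {f : MvPolynomial (Fin n) K} (hf : f ∈ indIdeal K n t ^ k) :
    Polynomial.X ^ (s * k) ∣ gradeHom K (Set.range e) f := by
  have hle : indIdeal K n t ≤ (Ideal.span {Polynomial.X ^ s}).comap (gradeHom K (Set.range e)) := by
    rw [indIdeal, Ideal.span_le]
    rintro _ ⟨F, hF, hFt, rfl⟩
    have hcard := two_mul_card_filter_le he hpar hmn hF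
    have hsum := Finset.card_filter_add_card_filter_not (s := F) fun v => ∀ j, e j ≠ v
    rw [SetLike.mem_coe, Ideal.mem_comap, Ideal.mem_span_singleton, map_prod]
    refine dvd_trans (pow_dvd_pow _ (show s ≤ (F.filter fun v => ¬ ∀ j, e j ≠ v).card by omega)) ?_
    refine dvd_trans ?_ (Finset.prod_dvd_prod_of_subset _ _ _
      (Finset.filter_subset (fun v => ¬ ∀ j, e j ≠ v) F))
    rw [← Finset.prod_const]
    refine Finset.prod_dvd_prod_of_dvd _ _ fun v hv => ?_
    have hv : v ∈ Set.range e := by simpa using (Finset.mem_filter.mp hv).2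
    rw [gradeHom_X_of_mem K hv]
    exact dvd_mul_left _ _
  have h := Ideal.le_comap_pow _ k (Ideal.pow_right_mono hle k hf)
  rwa [Ideal.mem_comap, Ideal.span_singleton_pow, Ideal.mem_span_singleton, ← pow_mul] at h

/-- If `n > 2t` and `k ≥ 1`, then every ideal `⟨x_{i₁}, …, x_{i_{n-2t+2ℓ}}⟩` with
`1 ≤ ℓ ≤ min t k`, `i₁ < ⋯ < i_{n-2t+2ℓ}`, and `i_j`, `j` of the same parity,
is an associated prime of `Iᵏ`.  The indices are encoded by a strictly monotone
map `e : Fin (n - 2t + 2ℓ) → Fin n`. -/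
theorem stmt4 (K : Type*) [Field K] (t n k ℓ : ℕ) (ht : 1 < t) (hn : 2 * t < n)
    (hk : 1 ≤ k) (hl1 : 1 ≤ ℓ) (hl2 : ℓ ≤ min t k)
    (e : Fin (n - 2 * t + 2 * ℓ) → Fin n) (he : StrictMono e)
    (hpar : ∀ j, ((e j : ℕ)) % 2 = ((j : ℕ)) % 2) :
    Ideal.span (Set.range fun j => X (e j)) ∈
      associatedPrimes (MvPolynomial (Fin n) K)
        (MvPolynomial (Fin n) K ⧸ (indIdeal K n t) ^ k) := by
  classical
  obtain ⟨d, rfl⟩ : ∃ d, ℓ = d + 1 := ⟨ℓ - 1, by omega⟩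
  obtain ⟨r, rfl⟩ : ∃ r, k = d + 1 + r := ⟨k - (d + 1), by omega⟩
  have hmn : (n - 2 * t + 2 * (d + 1)) % 2 = n % 2 := by omega
  have hst : n - (n - 2 * t + 2 * (d + 1)) + 2 * (d + 1) = 2 * t := by omega
  obtain ⟨A, hA, hAcard, hAD⟩ := exists_isIndepSet_card
    (show 2 * (d + 1) < n - 2 * t + 2 * (d + 1) by omega)
  obtain ⟨G, hGA, hGcard⟩ := Finset.exists_subset_card_eq (show d + 1 ≤ A.card by omega)
  set c : MvPolynomial (Fin n) K := ∏ v ∈ Finset.univ.filter (fun v => ∀ j, e j ≠ v), X v with hc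
  set p : MvPolynomial (Fin (n - 2 * t + 2 * (d + 1))) K :=
    (∏ v ∈ A, X v) ^ d * (∏ v ∈ G, X v) ^ r with hp
  set w : MvPolynomial (Fin n) K := rename e p * c ^ (d + 1 + r) with hw
  have hmem : ∀ j, X (e j) * w ∈ indIdeal K n t ^ (d + 1 + r) := by
    intro j
    obtain ⟨D, hDA, hDcard, hj, hjD⟩ := hAD j
    have h1 := Ideal.mul_mem_mul (X_mul_prod_pow_mem K hA hAcard hDA hDcard hj hjD)
      (Ideal.pow_mem_pow (prod_X_mem_indIdeal K (hA.mono hGA) hGcard) r)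
    rw [← pow_add, mul_assoc, ← hp] at h1
    have h2 := rename_mul_pow_mem K he hpar hmn hst h1
    rwa [map_mul, rename_X, mul_assoc] at h2
  have hw0 : w ≠ 0 := by
    have hX : ∀ (q : ℕ) (F : Finset (Fin q)), (∏ v ∈ F, X v : MvPolynomial (Fin q) K) ≠ 0 :=
      fun q F => Finset.prod_ne_zero_iff.mpr fun v _ => X_ne_zero v
    refine mul_ne_zero ?_ (pow_ne_zero _ (hX _ _))
    rw [Ne, map_eq_zero_iff _ (rename_injective e he.injective)]
    exact mul_ne_zero (pow_ne_zero _ (hX _ _)) (pow_ne_zero _ (hX _ _))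
  have hgrade : gradeHom K (Set.range e) w =
      Polynomial.C w * Polynomial.X ^ ((d + 2) * d + (d + 1) * r) := by
    have hF : ∀ F : Finset (Fin (n - 2 * t + 2 * (d + 1))),
        gradeHom K (Set.range e) (rename e (∏ v ∈ F, X v)) =
          Polynomial.C (rename e (∏ v ∈ F, X v)) * Polynomial.X ^ F.card := by
      intro F
      simp only [map_prod, rename_X, gradeHom_X_of_mem K (Set.mem_range_self _),
        Finset.prod_mul_distrib, Finset.prod_const]
    have hcgrade : gradeHom K (Set.range e) c = Polynomial.C c := by
      rw [hc, map_prod, map_prod]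
      refine Finset.prod_congr rfl fun v hv => gradeHom_X_of_notMem K ?_
      rintro ⟨j, hj⟩
      exact (Finset.mem_filter.mp hv).2 j hj
    simp only [hw, hp, map_mul, map_pow, hF, hcgrade, hAcard, hGcard, mul_pow, ← pow_mul, pow_add]
    ring
  have hspan : Ideal.span (Set.range fun j => X (e j)) =
      Ideal.span ((X : Fin n → MvPolynomial (Fin n) K) '' Set.range e) := by
    rw [← Set.range_comp]
    rfl
  rw [AssociatedPrimes.mem_iff, isAssociatedPrime_iff]
  refine ⟨hspan ▸ isPrime_span_image_X K _, Ideal.Quotient.mk _ w, ?_⟩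
  ext f
  rw [Submodule.mem_colon_singleton, Submodule.mem_bot]
  change _ ↔ Ideal.Quotient.mk _ (f * w) = 0
  rw [Ideal.Quotient.eq_zero_iff_mem]
  constructor
  · intro hf
    have hle : Ideal.span (Set.range fun j => X (e j)) ≤
        (indIdeal K n t ^ (d + 1 + r)).colon (Ideal.span {w}) := by
      rw [Ideal.span_le]
      rintro _ ⟨j, rfl⟩
      exact Ideal.mem_colon_span_singleton.mpr (hmem j)
    exact Ideal.mem_colon_span_singleton.mp (hle hf)
  · intro hf
    have h := X_pow_dvd_gradeHom K he hpar hmn hst hf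
    rw [map_mul, hgrade, ← mul_assoc,
      show (d + 1) * (d + 1 + r) = 1 + ((d + 2) * d + (d + 1) * r) by ring, pow_add, pow_one,
      mul_dvd_mul_iff_right (pow_ne_zero _ Polynomial.X_ne_zero), Polynomial.X_dvd_iff,
      Polynomial.coeff_mul_C, mul_eq_zero, or_iff_left hw0] at h
    rw [hspan]
    exact mem_span_of_coeff_gradeHom_eq_zero K h
end

section
/- Let t > 1 and n = 2t be integers, and let k ≥ 1. Then I^k admits the primary decomposition I^k = ⋂_{r=1}^{k} ⋂_{(i,j)} ⟨x_i^r, x_j^{k+1-r}⟩, where the inner intersection is over all pairs (i, j) with 1 ≤ i < j ≤ 2t, i odd and j even. -/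
open MvPolynomial

/-- Each block `{x_{2a+1}, x_{2a+2}}` of `P_{2t}` meets every independent set of size `t`. -/
theorem IsIndepSet.exists_div_two_eq {t : ℕ} {F : Finset (Fin (2 * t))}
    (hF : IsIndepSet (2 * t) F) (hc : F.card = t) {a : ℕ} (ha : a < t) :
    ∃ v ∈ F, (v : ℕ) / 2 = a := by
  have hinj : Set.InjOn (fun v : Fin (2 * t) => (v : ℕ) / 2) F := by
    intro x hx y hy hxy
    have h₁ := hF x hx y hy
    have h₂ := hF y hy x hx
    simp only at hxy
    ext
    omega
  have himage : F.image (fun v : Fin (2 * t) => (v : ℕ) / 2) = Finset.range t := by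
    refine Finset.eq_of_subset_of_card_le (fun b hb => ?_) ?_
    · obtain ⟨v, -, rfl⟩ := Finset.mem_image.1 hb
      have := v.isLt
      simp only [Finset.mem_range]
      omega
    · rw [Finset.card_image_of_injOn hinj, hc, Finset.card_range]
  exact Finset.mem_image.1 (himage.symm ▸ Finset.mem_range.2 ha)

/-- The pairs `{x_i, x_j}` with `i < j`, `i` odd, `j` even are vertex covers of the family of
independent sets of size `t` in `P_{2t}`. -/
theorem IsIndepSet.mem_or_mem_s5 {t : ℕ} {F : Finset (Fin (2 * t))}
    (hF : IsIndepSet (2 * t) F) (hc : F.card = t) {v₁ v₂ : Fin (2 * t)} (hlt : v₁ < v₂)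
    (h₁ : Even (v₁ : ℕ)) (h₂ : Odd (v₂ : ℕ)) : v₁ ∈ F ∨ v₂ ∈ F := by
  by_contra! h
  obtain ⟨h1, h2⟩ := h
  obtain ⟨a, ha⟩ := h₁
  obtain ⟨b, hb⟩ := h₂
  have hlt' : (v₁ : ℕ) < v₂ := hlt
  have key : ∀ c, a ≤ c → c ≤ b → ∃ v ∈ F, (v : ℕ) = 2 * c + 1 := by
    intro c hac
    induction c, hac using Nat.le_induction with
    | base =>
      intro _
      obtain ⟨v, hv, hva⟩ := hF.exists_div_two_eq hc (a := a) (by omega)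
      refine ⟨v, hv, ?_⟩
      have : (v : ℕ) ≠ v₁ := fun h => h1 (Fin.ext h ▸ hv)
      omega
    | succ c hac ih =>
      intro hcb
      obtain ⟨w, hw, hwc⟩ := ih (by omega)
      obtain ⟨v, hv, hva⟩ := hF.exists_div_two_eq hc (a := c + 1) (by omega)
      have := hF w hw v hv
      exact ⟨v, hv, by omega⟩
  obtain ⟨v, hv, hvb⟩ := key b (by omega) le_rfl
  exact h2 (Fin.ext (hvb.trans hb.symm) ▸ hv)

/-- A power of a sum of two ideals is contained in a sum of powers. -/
theorem Ideal.sup_pow_le_pow_sup_pow {R : Type*} [CommSemiring R] (I J : Ideal R) {k r s : ℕ}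
    (h : r + s ≤ k + 1) : (I ⊔ J) ^ k ≤ I ^ r ⊔ J ^ s := by
  rw [← Submodule.add_eq_sup, add_pow, Ideal.sum_eq_sup]
  refine Finset.sup_le fun m _ => le_trans Ideal.mul_le_left ?_
  rcases le_or_gt r m with hm | hm
  · exact le_sup_of_le_left (le_trans Ideal.mul_le_left (Ideal.pow_le_pow_right hm))
  · exact le_sup_of_le_right (le_trans Ideal.mul_le_right (Ideal.pow_le_pow_right (by omega)))

theorem indIdeal_pow_le_span (K : Type*) [Field K] {t k r : ℕ} (hr : r ≤ k)
    {v₁ v₂ : Fin (2 * t)} (hlt : v₁ < v₂) (h₁ : Even (v₁ : ℕ)) (h₂ : Odd (v₂ : ℕ)) :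
    indIdeal K (2 * t) t ^ k ≤ Ideal.span {X v₁ ^ r, X v₂ ^ (k + 1 - r)} := by
  have hle : indIdeal K (2 * t) t ≤ Ideal.span {X v₁} ⊔ Ideal.span {X v₂} := by
    refine Ideal.span_le.2 ?_
    rintro _ ⟨F, hF, hc, rfl⟩
    rcases hF.mem_or_mem_s5 hc hlt h₁ h₂ with h | h
    · exact Ideal.mem_sup_left (Ideal.mem_span_singleton.2 (Finset.dvd_prod_of_mem _ h))
    · exact Ideal.mem_sup_right (Ideal.mem_span_singleton.2 (Finset.dvd_prod_of_mem _ h))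
  rw [Ideal.span_insert, ← Ideal.span_singleton_pow, ← Ideal.span_singleton_pow]
  exact (Ideal.pow_right_mono hle k).trans (Ideal.sup_pow_le_pow_sup_pow _ _ (by omega))

open Classical in
/-- The independent set of `P_{2t}` attached to an exponent vector `e` at level `i`: it contains
the odd-indexed vertices of an initial segment, up to the first one whose exponent is less than
`i`, and the even-indexed vertices from there on. -/
noncomputable def levelSet {n : ℕ} (e : Fin n →₀ ℕ) (i : ℕ) : Finset (Fin n) :=
  {v | Even (v : ℕ) ↔ ∀ w ≤ v, Even (w : ℕ) → i ≤ e w}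

theorem mem_levelSet {n : ℕ} {e : Fin n →₀ ℕ} {i : ℕ} {v : Fin n} :
    v ∈ levelSet e i ↔ (Even (v : ℕ) ↔ ∀ w ≤ v, Even (w : ℕ) → i ≤ e w) := by
  simp [levelSet]

theorem isIndepSet_levelSet {n : ℕ} (e : Fin n →₀ ℕ) (i : ℕ) :
    IsIndepSet n (levelSet e i) := by
  intro v hv w hw hvw
  rw [mem_levelSet] at hv hw
  have hle : v ≤ w := Fin.le_def.2 (by omega)
  rcases Nat.even_or_odd (v : ℕ) with h | h
  · have hwo : ¬ Even (w : ℕ) := by rw [← hvw]; simpa [Nat.even_add_one] using h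
    refine hwo (hw.2 fun u hu hue => hv.1 h u ?_ hue)
    have : (u : ℕ) ≠ w := fun h => hwo (h ▸ hue)
    have : (u : ℕ) ≤ w := hu
    exact Fin.le_def.2 (by omega)
  · have hwe : Even (w : ℕ) := by rw [← hvw]; exact h.add_one
    exact Nat.not_even_iff_odd.2 h (hv.2 fun u hu hue => hw.1 hwe u (hu.trans hle) hue)

theorem card_levelSet {t : ℕ} (e : Fin (2 * t) →₀ ℕ) (i : ℕ) :
    (levelSet e i).card = t := by
  have hF := isIndepSet_levelSet e i
  refine (Finset.card_bij (s := levelSet e i) (t := Finset.range t)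
    (fun v _ => (v : ℕ) / 2) ?_ ?_ ?_).trans (Finset.card_range t)
  · intro v _
    have := v.isLt
    simp only [Finset.mem_range]
    omega
  · intro x hx y hy hxy
    have h₁ := hF x hx y hy
    have h₂ := hF y hy x hx
    ext
    omega
  · intro a ha
    rw [Finset.mem_range] at ha
    by_cases h : ∀ w : Fin (2 * t), (w : ℕ) ≤ 2 * a → Even (w : ℕ) → i ≤ e w
    · exact ⟨⟨2 * a, by omega⟩, mem_levelSet.2 (iff_of_true (by simp) h), by simp⟩
    · refine ⟨⟨2 * a + 1, by omega⟩, mem_levelSet.2 (iff_of_false (by simp) fun h' => h ?_),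
        by simp only; omega⟩
      exact fun w hw hwe => h' w (Fin.le_def.2 (by simp only; omega)) hwe

theorem card_filter_mem_levelSet_le {n k : ℕ} {e : Fin n →₀ ℕ}
    (he : ∀ r ∈ Finset.Icc 1 k, ∀ v₁ v₂ : Fin n, v₁ < v₂ → Even (v₁ : ℕ) → Odd (v₂ : ℕ) →
      r ≤ e v₁ ∨ k + 1 - r ≤ e v₂) (v : Fin n) :
    ((Finset.Icc 1 k).filter fun i => v ∈ levelSet e i).card ≤ e v := by
  rcases Nat.even_or_odd (v : ℕ) with h | h
  · calc _ ≤ (Finset.Icc 1 (e v)).card := Finset.card_le_card fun i hi => by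
          obtain ⟨hik, hi⟩ := Finset.mem_filter.1 hi
          exact Finset.mem_Icc.2
            ⟨(Finset.mem_Icc.1 hik).1, (mem_levelSet.1 hi).1 h v le_rfl h⟩
      _ = e v := by simp
  · calc _ ≤ (Finset.Ioc (k - e v) k).card := Finset.card_le_card fun i hi => by
          obtain ⟨hik, hi⟩ := Finset.mem_filter.1 hi
          have hv := Nat.not_even_iff_odd.2 h
          have hlow := mt (mem_levelSet.1 hi).2 hv
          push Not at hlow
          obtain ⟨w, hw, hwe, hwi⟩ := hlow
          have hne : w ≠ v := fun h => hv (h ▸ hwe)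
          have := he i hik w v (lt_of_le_of_ne hw hne) hwe h
          have := Finset.mem_Icc.1 hik
          exact Finset.mem_Ioc.2 (by omega)
      _ ≤ e v := by simp only [Nat.card_Ioc]; omega

theorem monomial_mem_indIdeal_pow_s5 (K : Type*) [Field K] {t k : ℕ} {e : Fin (2 * t) →₀ ℕ}
    (he : ∀ r ∈ Finset.Icc 1 k, ∀ v₁ v₂ : Fin (2 * t),
      v₁ < v₂ → Even (v₁ : ℕ) → Odd (v₂ : ℕ) → r ≤ e v₁ ∨ k + 1 - r ≤ e v₂) (c : K) :
    monomial e c ∈ indIdeal K (2 * t) t ^ k := by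
  classical
  have hmem : ∏ i ∈ Finset.Icc 1 k, ∏ v ∈ levelSet e i, (X v : MvPolynomial (Fin (2 * t)) K) ∈
      indIdeal K (2 * t) t ^ k := by
    have := Ideal.prod_mem_prod (s := Finset.Icc 1 k) (I := fun _ => indIdeal K (2 * t) t)
      (x := fun i => ∏ v ∈ levelSet e i, (X v : MvPolynomial (Fin (2 * t)) K))
      fun i _ => Ideal.subset_span
        ⟨levelSet e i, isIndepSet_levelSet e i, card_levelSet e i, rfl⟩
    simpa using this
  refine Ideal.mem_of_dvd _ ?_ hmem
  have hprod : ∏ i ∈ Finset.Icc 1 k, ∏ v ∈ levelSet e i, (X v : MvPolynomial (Fin (2 * t)) K) =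
      ∏ v, X v ^ ((Finset.Icc 1 k).filter fun i => v ∈ levelSet e i).card := by
    rw [Finset.prod_comm' (t' := Finset.univ)
      (s' := fun v => (Finset.Icc 1 k).filter fun i => v ∈ levelSet e i) (by simp)]
    simp
  rw [hprod, monomial_eq, Finsupp.prod_fintype _ _ (by simp)]
  exact (Finset.prod_dvd_prod_of_dvd _ _ fun v _ =>
    pow_dvd_pow _ (card_filter_mem_levelSet_le he v)).mul_left _

theorem le_or_le_of_mem_span_X_pow {K σ : Type*} [Field K] {f : MvPolynomial σ K}
    {v w : σ} {r s : ℕ} (hf : f ∈ Ideal.span {X v ^ r, X w ^ s}) {e : σ →₀ ℕ}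
    (he : e ∈ f.support) : r ≤ e v ∨ s ≤ e w := by
  have himage : ({X v ^ r, X w ^ s} : Set (MvPolynomial σ K)) =
      (fun m => monomial m 1) '' {Finsupp.single v r, Finsupp.single w s} := by
    simp [Set.image_pair, X_pow_eq_monomial]
  rw [himage, mem_ideal_span_monomial_image] at hf
  simpa [Finsupp.single_le_iff] using hf e he

/-- If `n = 2t` then for every `k ≥ 1`,
`Iᵏ = ⋂_{r=1}^{k} ⋂_{(i,j)} ⟨x_iʳ, x_j^{k+1-r}⟩`, the inner intersection being over
pairs `i < j` with `i` odd and `j` even.  In 0-based indexing `v = i - 1`,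
"`i` odd" becomes `Even (v₁ : ℕ)` and "`j` even" becomes `Odd (v₂ : ℕ)`. -/
theorem stmt5 (K : Type*) [Field K] (t n k : ℕ) (ht : 1 < t) (hn : n = 2 * t)
    (hk : 1 ≤ k) :
    (indIdeal K n t) ^ k =
      ⨅ r ∈ Finset.Icc 1 k, ⨅ (v₁ : Fin n) (v₂ : Fin n)
        (_ : v₁ < v₂ ∧ Even (v₁ : ℕ) ∧ Odd (v₂ : ℕ)),
          Ideal.span {X v₁ ^ r, X v₂ ^ (k + 1 - r)} := by
  subst hn
  refine le_antisymm ?_ fun f hf => ?_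
  · simp only [le_iInf_iff]
    rintro r hr v₁ v₂ ⟨hlt, h₁, h₂⟩
    exact indIdeal_pow_le_span K (Finset.mem_Icc.1 hr).2 hlt h₁ h₂
  · simp only [Ideal.mem_iInf] at hf
    rw [f.as_sum]
    exact Ideal.sum_mem _ fun e he => monomial_mem_indIdeal_pow_s5 K
      (fun r hr v₁ v₂ hlt h₁ h₂ =>
        le_or_le_of_mem_span_X_pow (hf r hr v₁ v₂ ⟨hlt, h₁, h₂⟩) he) _
end

section
/- Let n, t > 1 be integers with n ≥ 2t, let 1 ≤ ℓ ≤ t, and let 1 ≤ i_1 < i_2 < ⋯ < i_{n-2t+2ℓ} ≤ n be indices such that i_j and j have the same parity for every 1 ≤ j ≤ n-2t+2ℓ. Set B = {x_{i_1}, …, x_{i_{n-2t+2ℓ}}}. Then for every independent set S of P_n of size t, one has |S ∩ B| ≥ ℓ. -/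
open MvPolynomial

/-- If every `k` satisfying `p` is preceded by an even number of elements not satisfying `p`, and
no two consecutive numbers satisfy `q`, then `q` holds for at most half of the numbers below `k`
not satisfying `p`, up to a rounding error when an odd run ends with an element of `q`. -/
theorem two_mul_count_and_not_add_count_le (p q : ℕ → Prop) [DecidablePred p] [DecidablePred q]
    (hp : ∀ k, p k → k % 2 = Nat.count p k % 2) (hq : ∀ k, q k → ¬ q (k + 1)) (k : ℕ) :
    2 * Nat.count (fun m => q m ∧ ¬ p m) k + Nat.count p k ≤ k + 1 ∧
      (¬ ((k + Nat.count p k) % 2 = 1 ∧ ∃ m, m + 1 = k ∧ q m) →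
        2 * Nat.count (fun m => q m ∧ ¬ p m) k + Nat.count p k ≤ k) := by
  induction k with
  | zero => simp
  | succ k ih =>
    have hlast : (∃ m, m + 1 = k + 1 ∧ q m) ↔ q k := by simp
    have hprev : q k → ¬ ∃ m, m + 1 = k ∧ q m := by
      rintro h ⟨m, rfl, hm⟩
      exact hq m hm h
    have hpk := hp k
    rw [hlast, Nat.count_succ, Nat.count_succ]
    by_cases h1 : p k <;> by_cases h2 : q k <;> simp only [h1, h2, not_true_eq_false,
      not_false_eq_true, and_true, and_false, if_true, if_false] at * <;>
      grind

/-- The values of a strictly monotone `e : Fin m → Fin n` below `e j` are the `e i` with `i < j`. -/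
theorem count_exists_eq_of_strictMono {m n : ℕ} (e : Fin m → Fin n) (he : StrictMono e)
    [DecidablePred fun k : ℕ => ∃ i, (e i : ℕ) = k] (j : Fin m) :
    Nat.count (fun k => ∃ i, (e i : ℕ) = k) (e j) = j := by
  have h : {k ∈ Finset.range (e j) | ∃ i, (e i : ℕ) = k}
      = (Finset.Iio j).image (Fin.val ∘ e) := by
    ext k
    simp only [Finset.mem_filter, Finset.mem_range, Finset.mem_image, Finset.mem_Iio,
      Function.comp_apply]
    constructor
    · rintro ⟨hk, i, rfl⟩
      exact ⟨i, he.lt_iff_lt.1 hk, rfl⟩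
    · rintro ⟨i, hi, rfl⟩
      exact ⟨he hi, i, rfl⟩
  rw [Nat.count_eq_card_filter_range, h,
    Finset.card_image_of_injective _ (Fin.val_injective.comp he.injective), Fin.card_Iio]

/-- Counting the values of elements of a finset of `Fin n` below `n` gives its cardinality. -/
theorem count_eq_card_of_forall_iff {n : ℕ} (F : Finset (Fin n)) (p : ℕ → Prop) [DecidablePred p]
    (h : ∀ k, p k ↔ ∃ i ∈ F, (i : ℕ) = k) : Nat.count p n = F.card := by
  rw [Nat.count_eq_card_filter_range, ← Finset.card_image_of_injective F Fin.val_injective]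
  congr 1
  ext k
  simp only [Finset.mem_filter, Finset.mem_range, Finset.mem_image, h]
  constructor
  · exact fun hk => hk.2
  · rintro ⟨i, hi, rfl⟩
    exact ⟨i.2, i, hi, rfl⟩

/-- Let `n ≥ 2t`, `1 ≤ ℓ ≤ t`, and let `B = {x_{i₁} < ⋯ < x_{i_{n-2t+2ℓ}}}` with `i_j`
and `j` of the same parity for all `j` (indices encoded by a strictly monotone
`e : Fin (n - 2t + 2ℓ) → Fin n`).  Then any independent set `S` of `Pₙ` of size `t`
satisfies `|S ∩ B| ≥ ℓ`. -/
theorem stmt6 (n t ℓ : ℕ) (ht : 1 < t) (hn2 : 1 < n) (hn : 2 * t ≤ n)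
    (hl1 : 1 ≤ ℓ) (hl2 : ℓ ≤ t)
    (e : Fin (n - 2 * t + 2 * ℓ) → Fin n) (he : StrictMono e)
    (hpar : ∀ j, ((e j : ℕ)) % 2 = ((j : ℕ)) % 2)
    (S : Finset (Fin n)) (hS : IsIndepSet n S) (hcard : S.card = t) :
    ℓ ≤ (S ∩ Finset.image e Finset.univ).card := by
  classical
  set B := Finset.image e Finset.univ with hB
  set p : ℕ → Prop := fun k => ∃ i, (e i : ℕ) = k with hp
  set q : ℕ → Prop := fun k => ∃ i ∈ S, (i : ℕ) = k with hq
  have hp_parity : ∀ k, p k → k % 2 = Nat.count p k % 2 := by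
    rintro _ ⟨j, rfl⟩
    rw [count_exists_eq_of_strictMono e he j, hpar j]
  have hq_indep : ∀ k, q k → ¬ q (k + 1) := by
    rintro _ ⟨i, hi, rfl⟩ ⟨j, hj, hij⟩
    exact hS i hi j hj hij.symm
  have hcountB : Nat.count p n = n - 2 * t + 2 * ℓ := by
    rw [count_eq_card_of_forall_iff B p (by simp [hp, hB]), hB,
      Finset.card_image_of_injective _ he.injective, Finset.card_univ, Fintype.card_fin]
  have hcountS : Nat.count (fun m => q m ∧ ¬ p m) n = (S \ B).card := by
    refine count_eq_card_of_forall_iff _ _ fun k => ?_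
    constructor
    · rintro ⟨⟨i, hi, rfl⟩, hk⟩
      refine ⟨i, Finset.mem_sdiff.2 ⟨hi, fun hiB => hk ?_⟩, rfl⟩
      obtain ⟨j, -, rfl⟩ := Finset.mem_image.1 hiB
      exact ⟨j, rfl⟩
    · rintro ⟨i, hi, rfl⟩
      obtain ⟨hiS, hiB⟩ := Finset.mem_sdiff.1 hi
      refine ⟨⟨i, hiS, rfl⟩, fun ⟨j, hj⟩ => hiB ?_⟩
      exact Finset.mem_image.2 ⟨j, Finset.mem_univ j, Fin.ext hj⟩
  have hbound := (two_mul_count_and_not_add_count_le p q hp_parity hq_indep n).2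
    (by rw [hcountB]; omega)
  rw [hcountB, hcountS] at hbound
  have hsplit := Finset.card_inter_add_card_sdiff S B
  omega
end

section
/- Let n, t > 1 be integers with n ≥ 2t, let 1 ≤ ℓ ≤ t, and let 1 ≤ i_1 < i_2 < ⋯ < i_{n-2t+2ℓ} ≤ n be indices such that i_j and j have the same parity for every 1 ≤ j ≤ n-2t+2ℓ. Set B = {x_{i_1}, …, x_{i_{n-2t+2ℓ}}} and A = {x_1, …, x_n} \ B. Suppose H ⊆ B has |H| = ℓ and H contains no two elements in consecutive positions of B, i.e., there is no j with both x_{i_j} ∈ H and x_{i_{j+1}} ∈ H. Then the monomial x^H · x^A belongs to I. -/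
open MvPolynomial

/-- Greedy selection on an initial segment of the path. If every element of `B` has the parity of
its position in `B`, and `H ⊆ B` has no two elements in consecutive positions of `B`, then there
is an independent set in `H ∪ Bᶜ` below `N` whose size is determined up to rounding by the number
of elements of `H` and of `Bᶜ` below `N`. -/
theorem exists_indep_finset_below (B H : ℕ → Prop) [DecidablePred B]
    [DecidablePred H] (hHB : ∀ v, H v → B v) (M : ℕ)
    (hpar : ∀ v < M, B v → v % 2 = Nat.count B v % 2)
    (hcons : ∀ u v, u < v → v < M → H u → H v → ∃ w, u < w ∧ w < v ∧ B w)
    (N : ℕ) (hN : N ≤ M) :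
    ∃ F : Finset ℕ, (∀ v ∈ F, v < N ∧ (H v ∨ ¬ B v)) ∧ (∀ i ∈ F, i + 1 ∉ F) ∧
      ∃ q : Prop, ((∃ i ∈ F, i + 1 = N) → q) ∧
      (N % 2 = Nat.count B N % 2 →
        (q → ∃ u < N, H u ∧ ∀ w, u < w → w < N → ¬ B w) ∧
        2 * F.card + Nat.count B N = N + 2 * Nat.count H N) ∧
      (N % 2 ≠ Nat.count B N % 2 →
        (¬ q → ∃ u < N, H u ∧ ∀ w, u < w → w < N → ¬ B w) ∧
        (q → 2 * F.card + Nat.count B N = N + 2 * Nat.count H N + 1) ∧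
        (¬ q → 2 * F.card + Nat.count B N + 1 = N + 2 * Nat.count H N)) := by
  induction N with
  | zero => exact ⟨∅, by simp, by simp, False, by simp, by simp, by simp⟩
  | succ N ih =>
    obtain ⟨F, hF, hind, q, hlast, heven, hodd⟩ := ih (by omega)
    have hnot : N ∉ F := fun h => absurd (hF N h).1 (lt_irrefl N)
    have hlt : ∀ v ∈ F, v < N := fun v hv => (hF v hv).1
    have hins : ¬ q → ∀ i ∈ insert N F, i + 1 ∉ insert N F := by
      intro hq i hi
      rw [Finset.mem_insert] at hi ⊢
      rintro (h | h)
      · rcases hi with rfl | hi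
        · omega
        · exact hq (hlast ⟨i, hi, h⟩)
      · rcases hi with rfl | hi
        · have := hlt _ h
          omega
        · exact hind i hi h
    have hext : ¬ B N → (∃ u < N, H u ∧ ∀ w, u < w → w < N → ¬ B w) →
        ∃ u < N + 1, H u ∧ ∀ w, u < w → w < N + 1 → ¬ B w := by
      rintro hB ⟨u, hu, hHu, hw⟩
      refine ⟨u, by omega, hHu, fun w h₁ h₂ => ?_⟩
      rcases Nat.lt_succ_iff_lt_or_eq.mp h₂ with h | rfl
      · exact hw w h₁ h
      · exact hB
    by_cases hB : B N
    · have hp := hpar N (by omega) hB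
      obtain ⟨hs, hc⟩ := heven hp
      by_cases hH : H N
      · have hq : ¬ q := by
          intro hq
          obtain ⟨u, hu, hHu, hw⟩ := hs hq
          obtain ⟨w, h₁, h₂, h₃⟩ := hcons u N hu (by omega) hHu hH
          exact hw w h₁ h₂ h₃
        refine ⟨insert N F, ?_, hins hq, True, fun _ => trivial, fun _ => ⟨fun _ => ?_, ?_⟩,
          fun h => ?_⟩
        · intro v hv
          rcases Finset.mem_insert.mp hv with rfl | hv
          · exact ⟨by omega, Or.inl hH⟩
          · exact ⟨(hlt v hv).trans (Nat.lt_succ_self N), (hF v hv).2⟩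
        · exact ⟨N, by omega, hH, fun w _ _ => by omega⟩
        · rw [Finset.card_insert_of_notMem hnot, Nat.count_succ, Nat.count_succ, if_pos hB,
            if_pos hH]
          omega
        · rw [Nat.count_succ, if_pos hB] at h
          omega
      · refine ⟨F, fun v hv => ⟨(hlt v hv).trans (Nat.lt_succ_self N), (hF v hv).2⟩, hind, False,
          ?_, fun _ => ⟨False.elim, ?_⟩, fun h => ?_⟩
        · rintro ⟨i, hi, h⟩
          have := hlt i hi
          omega
        · rw [Nat.count_succ, Nat.count_succ, if_pos hB, if_neg hH]
          omega
        · rw [Nat.count_succ, if_pos hB] at h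
          omega
    · have hH : ¬ H N := fun h => hB (hHB N h)
      have hcB : Nat.count B (N + 1) = Nat.count B N := by simp [Nat.count_succ, hB]
      have hcH : Nat.count H (N + 1) = Nat.count H N := by simp [Nat.count_succ, hH]
      rw [hcB, hcH]
      by_cases hq : q
      · refine ⟨F, fun v hv => ⟨(hlt v hv).trans (Nat.lt_succ_self N), (hF v hv).2⟩, hind, False,
          ?_, fun h => ⟨False.elim, ?_⟩,
          fun h => ⟨fun _ => ?_, False.elim, fun _ => ?_⟩⟩
        · rintro ⟨i, hi, h⟩
          have := hlt i hi
          omega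
        · have := (hodd (by omega)).2.1 hq
          omega
        · exact hext hB ((heven (by omega)).1 hq)
        · have := (heven (by omega)).2
          omega
      · refine ⟨insert N F, ?_, hins hq, True, fun _ => trivial, fun h => ⟨fun _ => ?_, ?_⟩,
          fun h => ⟨fun h' => absurd trivial h', fun _ => ?_, fun h' => absurd trivial h'⟩⟩
        · intro v hv
          rcases Finset.mem_insert.mp hv with rfl | hv
          · exact ⟨by omega, Or.inr hB⟩
          · exact ⟨(hlt v hv).trans (Nat.lt_succ_self N), (hF v hv).2⟩
        · exact hext hB ((hodd (by omega)).1 hq)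
        · have := (hodd (by omega)).2.2 hq
          rw [Finset.card_insert_of_notMem hnot]
          omega
        · have := (heven (by omega)).2
          rw [Finset.card_insert_of_notMem hnot]
          omega

/-- The number of values below `N` of an injective function, counted on the index side. -/
theorem count_exists_val_eq_card {m n : ℕ} (e : Fin m → Fin n) (he : Function.Injective e)
    [DecidablePred fun v : ℕ => ∃ j, (e j : ℕ) = v] (N : ℕ) :
    Nat.count (fun v => ∃ j, (e j : ℕ) = v) N =
      (Finset.univ.filter fun j => (e j : ℕ) < N).card := by
  rw [Nat.count_eq_card_filter_range,
    ← Finset.card_image_of_injective _ (Fin.val_injective.comp he)]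
  congr 1
  ext v
  simp only [Finset.mem_filter, Finset.mem_range, Finset.mem_image, Finset.mem_univ, true_and,
    Function.comp_apply]
  constructor
  · rintro ⟨h, j, rfl⟩
    exact ⟨j, h, rfl⟩
  · rintro ⟨j, h, rfl⟩
    exact ⟨h, j, rfl⟩

/-- Let `n ≥ 2t`, `1 ≤ ℓ ≤ t`, and `B = {x_{i₁} < ⋯ < x_{i_{n-2t+2ℓ}}}` with `i_j`
and `j` of the same parity (indices encoded by a strictly monotone
`e : Fin (n - 2t + 2ℓ) → Fin n`), and `A` the complement of `B`.  If `H ⊆ B` has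
`|H| = ℓ` and contains no two elements in consecutive positions of `B`, then
the monomial `x^H · x^A` belongs to `I = Ind_t(Pₙ)`. -/
theorem stmt7 (K : Type*) [Field K] (n t ℓ : ℕ) (ht : 1 < t) (hn2 : 1 < n)
    (hn : 2 * t ≤ n) (hl1 : 1 ≤ ℓ) (hl2 : ℓ ≤ t)
    (e : Fin (n - 2 * t + 2 * ℓ) → Fin n) (he : StrictMono e)
    (hpar : ∀ j, ((e j : ℕ)) % 2 = ((j : ℕ)) % 2)
    (H : Finset (Fin n)) (hHB : H ⊆ Finset.image e Finset.univ) (hH : H.card = ℓ)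
    (hcons : ∀ j₁ j₂ : Fin (n - 2 * t + 2 * ℓ), (j₁ : ℕ) + 1 = (j₂ : ℕ) →
      e j₁ ∈ H → e j₂ ∉ H) :
    (∏ v ∈ H, (X v : MvPolynomial (Fin n) K)) *
        ∏ v ∈ Finset.univ \ Finset.image e Finset.univ, X v ∈
      indIdeal K n t := by
  classical
  let B : ℕ → Prop := fun v => ∃ j, (e j : ℕ) = v
  let H' : ℕ → Prop := fun v => ∃ u ∈ H, (u : ℕ) = v
  have hB_of_mem : ∀ u ∈ H, ∃ j, e j = u := fun u hu => by simpa using hHB hu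
  have hcountB : Nat.count B n = n - 2 * t + 2 * ℓ := by
    refine (count_exists_val_eq_card e he.injective n).trans ?_
    simp
  have hcount_lt : ∀ j, Nat.count B (e j) = j := by
    intro j
    refine (count_exists_val_eq_card e he.injective _).trans ?_
    have : (Finset.univ.filter fun i => (e i : ℕ) < e j) = Finset.Iio j := by
      ext i
      simp [he.lt_iff_lt]
    rw [this, Fin.card_Iio]
  have hcountH : Nat.count H' n = ℓ := by
    rw [Nat.count_eq_card_filter_range, ← hH, ← Finset.card_image_of_injective H Fin.val_injective]
    congr 1
    ext v
    simp only [Finset.mem_filter, Finset.mem_range, Finset.mem_image, H']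
    exact ⟨fun h => h.2, fun ⟨u, hu, h⟩ => ⟨h ▸ u.2, u, hu, h⟩⟩
  obtain ⟨F, hF, hind, q, -, heven, -⟩ := exists_indep_finset_below B H'
    (by
      rintro v ⟨u, hu, rfl⟩
      obtain ⟨j, rfl⟩ := hB_of_mem u hu
      exact ⟨j, rfl⟩) n
    (by
      rintro v - ⟨j, rfl⟩
      rw [hcount_lt, hpar])
    (by
      rintro _ _ huv - ⟨u, hu, rfl⟩ ⟨v, hv, rfl⟩
      obtain ⟨i, rfl⟩ := hB_of_mem u hu
      obtain ⟨j, rfl⟩ := hB_of_mem v hv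
      have hij : i < j := he.lt_iff_lt.mp huv
      have hne : (i : ℕ) + 1 ≠ j := fun h => hcons i j h hu hv
      have hlt : (i : ℕ) + 1 < j := by omega
      exact ⟨e ⟨i + 1, hlt.trans j.2⟩, he (Fin.lt_def.mpr (Nat.lt_succ_self _)),
        he (Fin.lt_def.mpr hlt), _, rfl⟩) n le_rfl
  have hcard := (heven (by omega)).2
  rw [hcountB, hcountH] at hcard
  have hFn : ∀ v ∈ F, v < n := fun v hv => (hF v hv).1
  have hdisj : Disjoint H (Finset.univ \ Finset.image e Finset.univ) :=
    Finset.disjoint_sdiff.mono_left hHB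
  rw [← Finset.prod_union hdisj]
  refine Ideal.mem_of_dvd _ (Finset.prod_dvd_prod_of_subset (F.attachFin hFn) _ _ ?_)
    (Ideal.subset_span ⟨F.attachFin hFn, ?_, ?_, rfl⟩)
  · intro v hv
    rw [Finset.mem_attachFin] at hv
    rcases (hF v hv).2 with ⟨u, hu, h⟩ | h
    · exact Finset.mem_union_left _ (Fin.ext h ▸ hu)
    · refine Finset.mem_union_right _ ?_
      simp only [Finset.mem_sdiff, Finset.mem_univ, Finset.mem_image, true_and]
      rintro ⟨j, rfl⟩
      exact h ⟨j, rfl⟩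
  · intro i hi j hj h
    rw [Finset.mem_attachFin] at hi hj
    exact hind i hi (h ▸ hj)
  · rw [Finset.card_attachFin]
    omega
end

section
/- Let n, t > 1 be integers with n ≥ 2t, let k ≥ 1, and let P be an associated prime ideal of I^k. Let A = {x_i : 1 ≤ i ≤ n, x_i ∉ P} and let P_n[A] denote the induced subgraph of P_n on the vertex set A. Then every connected component of P_n[A] has an even number of vertices. -/
open MvPolynomial

/-- `s` dominates the exponent vector of a product of `k` generators of `indIdeal K n t`. -/
def DominatesIndepSets (n t k : ℕ) (s : Fin n → ℕ) : Prop :=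
  ∃ F : Fin k → Finset (Fin n), (∀ i, IsIndepSet n (F i) ∧ (F i).card = t) ∧
    ∀ v, (Finset.univ.filter fun i => v ∈ F i).card ≤ s v

/-- An independent set which misses one of the two outer neighbours of an interval `[p, q]` with
an odd number of vertices can be exchanged for one of the same size missing both of them,
adding only vertices of the interval. -/
lemma IsIndepSet.exists_exchange {n p q : ℕ} {F : Finset (Fin n)} (hF : IsIndepSet n F)
    (hpq : p ≤ q) (hq : q < n) (hev : Even (q - p))
    (h : (∀ x ∈ F, (x : ℕ) + 1 ≠ p) ∨ ∀ x ∈ F, (x : ℕ) ≠ q + 1) :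
    ∃ F' : Finset (Fin n), IsIndepSet n F' ∧ F'.card = F.card ∧
      (∀ x ∈ F', x ∈ F ∨ p ≤ x ∧ (x : ℕ) ≤ q) ∧
      ∀ x ∈ F', (x : ℕ) + 1 ≠ p ∧ (x : ℕ) ≠ q + 1 := by
  classical
  obtain ⟨s, hs⟩ := hev
  set J := F.filter fun x : Fin n => p ≤ (x : ℕ) + 1 ∧ (x : ℕ) ≤ q + 1 with hJ
  set E : Finset (Fin n) :=
    (Finset.range (s + 1)).attach.image fun i => ⟨p + 2 * i.1, by
      have := Finset.mem_range.1 i.2; omega⟩ with hE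
  have hmemE : ∀ x ∈ E, ∃ i < s + 1, (x : ℕ) = p + 2 * i := by
    intro x hx
    simp only [hE, Finset.mem_image, Finset.mem_attach, true_and, Subtype.exists,
      Finset.mem_range] at hx
    obtain ⟨i, hi, rfl⟩ := hx
    exact ⟨i, hi, rfl⟩
  have hcardE : E.card = s + 1 := by
    rw [hE, Finset.card_image_of_injective, Finset.card_attach, Finset.card_range]
    intro a b hab
    simp only [Fin.mk.injEq] at hab
    exact Subtype.ext (by omega)
  have hcardJ : J.card ≤ s + 1 := by
    rw [← Finset.card_range (s + 1)]
    rcases h with h | h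
    · refine Finset.card_le_card_of_injOn (fun x => ((x : ℕ) - p) / 2) ?_ ?_
      · intro x hx
        simp only [hJ, Finset.coe_filter, Set.mem_ofPred_eq] at hx
        have := h x hx.1
        simp only [Finset.coe_range, Set.mem_Iio]
        omega
      · intro x hx y hy hxy
        simp only [hJ, Finset.coe_filter, Set.mem_ofPred_eq] at hx hy hxy
        have h1 := h x hx.1
        have h2 := h y hy.1
        have h3 := hF x hx.1 y hy.1
        have h4 := hF y hy.1 x hx.1
        exact Fin.ext (by omega)
    · refine Finset.card_le_card_of_injOn (fun x => ((x : ℕ) + 1 - p) / 2) ?_ ?_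
      · intro x hx
        simp only [hJ, Finset.coe_filter, Set.mem_ofPred_eq] at hx
        have := h x hx.1
        simp only [Finset.coe_range, Set.mem_Iio]
        omega
      · intro x hx y hy hxy
        simp only [hJ, Finset.coe_filter, Set.mem_ofPred_eq] at hx hy hxy
        have h1 := h x hx.1
        have h2 := h y hy.1
        have h3 := hF x hx.1 y hy.1
        have h4 := hF y hy.1 x hx.1
        exact Fin.ext (by omega)
  have hmem : ∀ x ∈ (F \ J) ∪ E, (x ∈ F ∧ ((x : ℕ) + 1 < p ∨ q + 1 < x)) ∨
      ∃ i < s + 1, (x : ℕ) = p + 2 * i := by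
    intro x hx
    rcases Finset.mem_union.1 hx with hx | hx
    · left
      simp only [hJ, Finset.mem_sdiff, Finset.mem_filter] at hx
      refine ⟨hx.1, ?_⟩
      have := hx.2
      by_contra hcon
      exact this ⟨hx.1, by omega, by omega⟩
    · exact Or.inr (hmemE x hx)
  have hdisj : Disjoint (F \ J) E := by
    rw [Finset.disjoint_left]
    intro x hx hxE
    obtain ⟨i, hi, hxi⟩ := hmemE x hxE
    simp only [hJ, Finset.mem_sdiff, Finset.mem_filter] at hx
    exact hx.2 ⟨hx.1, by omega, by omega⟩
  have hcard : F.card ≤ ((F \ J) ∪ E).card := by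
    rw [Finset.card_union_of_disjoint hdisj, hcardE]
    have hJF : J ⊆ F := Finset.filter_subset _ F
    have := Finset.card_sdiff_add_card_eq_card hJF
    omega
  obtain ⟨F', hsub, hF'⟩ := Finset.exists_subset_card_eq hcard
  refine ⟨F', ?_, hF', ?_, ?_⟩
  · intro x hx y hy
    rcases hmem x (hsub hx) with ⟨h1, h1'⟩ | ⟨i, hi, h1⟩ <;>
      rcases hmem y (hsub hy) with ⟨h2, h2'⟩ | ⟨j, hj, h2⟩
    · exact hF x h1 y h2
    · omega
    · omega
    · omega
  · intro x hx
    rcases hmem x (hsub hx) with ⟨h1, h1'⟩ | ⟨i, hi, h1⟩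
    · exact Or.inl h1
    · exact Or.inr (by omega)
  · intro x hx
    rcases hmem x (hsub hx) with ⟨h1, h1'⟩ | ⟨i, hi, h1⟩ <;> omega

/-- Minimal domination at an outer neighbour `v` of an odd interval `[p, q]` of free vertices
forces both outer neighbours to exist, and a strictly larger exponent at the other one. -/
lemma DominatesIndepSets.lt_of_outer {n t k p q : ℕ} {A : Set (Fin n)} {a m : Fin n → ℕ}
    (ha : ∀ v ∈ A, a v = k) (hnot : ¬ DominatesIndepSets n t k (a + m))
    (hpq : p ≤ q) (hq : q < n) (hev : Even (q - p))
    (hA : ∀ x : Fin n, p ≤ x → (x : ℕ) ≤ q → x ∈ A) {v : Fin n}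
    (hv : (v : ℕ) + 1 = p ∨ (v : ℕ) = q + 1)
    (hdom : DominatesIndepSets n t k (Pi.single v 1 + m)) :
    (∃ x : Fin n, (x : ℕ) + 1 = p) ∧ (∃ x : Fin n, (x : ℕ) = q + 1) ∧
      ∀ u : Fin n, ((u : ℕ) + 1 = p ∨ (u : ℕ) = q + 1) → u ≠ v → m v < m u := by
  classical
  obtain ⟨F, hF, hle⟩ := hdom
  have hle' : ∀ u ≠ v, (Finset.univ.filter fun i => u ∈ F i).card ≤ m u := by
    intro u hu
    simpa [hu] using hle u
  have hlt : m v < (Finset.univ.filter fun i => v ∈ F i).card := by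
    by_contra! hcon
    refine hnot ⟨F, hF, fun u => ?_⟩
    by_cases hu : u = v
    · subst hu
      exact hcon.trans (Nat.le_add_left _ _)
    · exact (hle' u hu).trans (Nat.le_add_left _ _)
  have key : ∀ i, v ∈ F i → (∃ x ∈ F i, (x : ℕ) + 1 = p) ∧ ∃ x ∈ F i, (x : ℕ) = q + 1 := by
    intro i hi
    by_contra hcon
    obtain ⟨F', hF', hcard, hsub, hout⟩ := (hF i).1.exists_exchange hpq hq hev (by
      by_contra! h
      exact hcon h)
    refine hnot ⟨Function.update F i F', fun j => ?_, fun u => ?_⟩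
    · by_cases hj : j = i
      · subst hj
        simpa using ⟨hF', hcard.trans (hF j).2⟩
      · simpa [hj] using hF j
    · by_cases huA : u ∈ A
      · have := (Finset.univ.filter fun j => u ∈ Function.update F i F' j).card_le_univ
        rw [Fintype.card_fin] at this
        rw [Pi.add_apply, ha u huA]
        omega
      refine le_trans ?_ (Nat.le_add_left _ _)
      have hsub' : (Finset.univ.filter fun j => u ∈ Function.update F i F' j) ⊆
          Finset.univ.filter fun j => u ∈ F j := by
        intro j hj
        simp only [Finset.mem_filter, Finset.mem_univ, true_and] at hj ⊢
        by_cases hji : j = i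
        · subst hji
          rw [Function.update_self] at hj
          exact (hsub u hj).resolve_right fun h => huA (hA u h.1 h.2)
        · rwa [Function.update_of_ne hji] at hj
      by_cases hu : u = v
      · subst hu
        have hss : (Finset.univ.filter fun j => u ∈ Function.update F i F' j) ⊂
            Finset.univ.filter fun j => u ∈ F j := by
          refine (Finset.ssubset_iff_of_subset hsub').2 ⟨i, by simpa using hi, ?_⟩
          simp only [Finset.mem_filter, Finset.mem_univ, true_and, Function.update_self]
          intro hcon'
          have := hout u hcon'
          omega
        have h1 := Finset.card_lt_card hss
        have h2 := hle u
        simp only [Pi.add_apply, Pi.single_eq_same] at h2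
        omega
      · exact (Finset.card_le_card hsub').trans (hle' u hu)
  obtain ⟨i, hi⟩ := Finset.card_pos.1 (Nat.zero_lt_of_lt hlt)
  obtain ⟨⟨x, -, hx⟩, ⟨y, -, hy⟩⟩ := key i (by simpa using hi)
  refine ⟨⟨x, hx⟩, ⟨y, hy⟩, fun u hu huv => ?_⟩
  refine hlt.trans_le ((Finset.card_le_card fun i hi => ?_).trans (hle' u huv))
  simp only [Finset.mem_filter, Finset.mem_univ, true_and] at hi ⊢
  obtain ⟨⟨x, hx, hxp⟩, ⟨y, hy, hyq⟩⟩ := key i hi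
  rcases hu with hu | hu
  · rwa [show u = x from Fin.ext (by omega)]
  · rwa [show u = y from Fin.ext (by omega)]

/-- A maximal interval of free vertices has an even number of vertices. -/
lemma DominatesIndepSets.odd_of_maximal_interval {n t k p q : ℕ} (hn : 2 * t ≤ n)
    {A : Set (Fin n)} {a m : Fin n → ℕ}
    (ha : ∀ v ∈ A, a v = k) (hnot : ¬ DominatesIndepSets n t k (a + m))
    (hdom : ∀ v ∉ A, DominatesIndepSets n t k (Pi.single v 1 + m))
    (hpq : p ≤ q) (hq : q < n) (hA : ∀ x : Fin n, p ≤ x → (x : ℕ) ≤ q → x ∈ A)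
    (hp' : ∀ x : Fin n, (x : ℕ) + 1 = p → x ∉ A) (hq' : ∀ x : Fin n, (x : ℕ) = q + 1 → x ∉ A) :
    ¬ Even (q - p) := by
  classical
  intro hev
  have hout : ∀ v : Fin n, (v : ℕ) + 1 = p ∨ (v : ℕ) = q + 1 → False := by
    intro v hv
    have step : ∀ v : Fin n, (v : ℕ) + 1 = p ∨ (v : ℕ) = q + 1 →
        DominatesIndepSets n t k (Pi.single v 1 + m) := fun v hv =>
      hdom v (hv.elim (hp' v) (hq' v))
    obtain ⟨⟨x, hx⟩, ⟨y, hy⟩, -⟩ := lt_of_outer ha hnot hpq hq hev hA hv (step v hv)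
    have hxy : x ≠ y := by
      rintro rfl
      omega
    have h1 := (lt_of_outer ha hnot hpq hq hev hA (.inl hx) (step x (.inl hx))).2.2
      y (.inr hy) hxy.symm
    have h2 := (lt_of_outer ha hnot hpq hq hev hA (.inr hy) (step y (.inr hy))).2.2
      x (.inl hx) hxy
    omega
  have hp0 : p = 0 := by
    by_contra h
    exact hout ⟨p - 1, by omega⟩ (.inl (by simp only; omega))
  have hqn : q + 1 = n := by
    by_contra h
    exact hout ⟨q + 1, by omega⟩ (.inr rfl)
  have hF : ∃ F : Finset (Fin n), IsIndepSet n F ∧ F.card = t := by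
    refine ⟨Finset.univ.image fun i : Fin t => ⟨2 * i, by omega⟩, fun x hx y hy => ?_, ?_⟩
    · obtain ⟨i, -, rfl⟩ := Finset.mem_image.1 hx
      obtain ⟨j, -, rfl⟩ := Finset.mem_image.1 hy
      simp only
      omega
    · rw [Finset.card_image_of_injective, Finset.card_univ, Fintype.card_fin]
      intro i j hij
      simp only [Fin.mk.injEq] at hij
      exact Fin.ext (by omega)
  obtain ⟨F, hF⟩ := hF
  refine hnot ⟨fun _ => F, fun _ => hF, fun v => ?_⟩
  rw [Pi.add_apply, ha v (hA v (by omega) (by omega))]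
  exact (Finset.card_le_univ _).trans (by simp)

lemma mem_indIdeal_pow {K : Type*} [Field K] {n t k : ℕ} {f : MvPolynomial (Fin n) K} :
    f ∈ indIdeal K n t ^ k ↔ ∀ s ∈ f.support, DominatesIndepSets n t k s := by
  classical
  have hprod : ∀ F : Fin k → Finset (Fin n),
      ∏ i, ∏ v ∈ F i, (X v : MvPolynomial (Fin n) K) =
        monomial (Finsupp.equivFunOnFinite.symm
          fun v => (Finset.univ.filter fun i => v ∈ F i).card) 1 := by
    intro F
    have h : ∀ i, ∏ v ∈ F i, (X v : MvPolynomial (Fin n) K) =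
        ∏ v, if v ∈ F i then X v else 1 := by
      intro i
      rw [Finset.prod_ite_mem, Finset.univ_inter]
    simp_rw [h]
    rw [Finset.prod_comm, monomial_eq, map_one, one_mul, Finsupp.prod_fintype _ _ (by simp)]
    refine Finset.prod_congr rfl fun v _ => ?_
    rw [Finset.prod_ite, Finset.prod_const, Finset.prod_const_one, mul_one]
    rfl
  have hspan : indIdeal K n t ^ k = Ideal.span ((fun s => monomial s (1 : K)) ''
      {s | ∃ F : Fin k → Finset (Fin n), (∀ i, IsIndepSet n (F i) ∧ (F i).card = t) ∧
        s = Finsupp.equivFunOnFinite.symm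
          fun v => (Finset.univ.filter fun i => v ∈ F i).card}) := by
    rw [indIdeal, Ideal.span, Submodule.span_pow]
    congr 1
    ext g
    rw [Set.mem_pow]
    constructor
    · rintro ⟨φ, rfl⟩
      choose F hF using fun i => (φ i).2
      refine ⟨_, ⟨F, fun i => ⟨(hF i).1, (hF i).2.1⟩, rfl⟩, ?_⟩
      rw [List.prod_ofFn]
      refine (hprod F).symm.trans ?_
      exact Finset.prod_congr rfl fun i _ => (hF i).2.2.symm
    · rintro ⟨_, ⟨F, hF, rfl⟩, rfl⟩
      refine ⟨fun i => ⟨_, F i, (hF i).1, (hF i).2, rfl⟩, ?_⟩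
      rw [List.prod_ofFn]
      exact hprod F
  rw [hspan, mem_ideal_span_monomial_image]
  refine forall₂_congr fun s _ => ⟨?_, ?_⟩
  · rintro ⟨_, ⟨F, hF, rfl⟩, hle⟩
    exact ⟨F, hF, fun v => hle v⟩
  · rintro ⟨F, hF, hle⟩
    exact ⟨_, ⟨F, hF, rfl⟩, fun v => hle v⟩

/-- An associated prime of a power of `indIdeal K n t` is witnessed by an exponent vector. -/
lemma exists_exponent_of_mem_associatedPrimes {K : Type*} [Field K] {n t k : ℕ}
    {P : Ideal (MvPolynomial (Fin n) K)}
    (hP : P ∈ associatedPrimes (MvPolynomial (Fin n) K)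
      (MvPolynomial (Fin n) K ⧸ indIdeal K n t ^ k)) :
    ∃ a m : Fin n → ℕ, (∀ v, (X v : MvPolynomial (Fin n) K) ∉ P → a v = k) ∧
      ¬ DominatesIndepSets n t k (a + m) ∧
      ∀ v, (X v : MvPolynomial (Fin n) K) ∈ P →
        DominatesIndepSets n t k (Pi.single v 1 + m) := by
  classical
  obtain ⟨hprime, x, hx⟩ := isAssociatedPrime_iff.1 (AssociatedPrimes.mem_iff.1 hP)
  obtain ⟨f, rfl⟩ := Ideal.Quotient.mk_surjective x
  have hmem : ∀ r, r ∈ P ↔ r * f ∈ indIdeal K n t ^ k := by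
    intro r
    rw [hx, Submodule.mem_colon_singleton, Submodule.mem_bot, ← Ideal.Quotient.eq_zero_iff_mem,
      map_mul]
    rfl
  let a : Fin n →₀ ℕ := Finsupp.equivFunOnFinite.symm
    fun v => if (X v : MvPolynomial (Fin n) K) ∈ P then 0 else k
  have ha : ∀ v, a v = if (X v : MvPolynomial (Fin n) K) ∈ P then 0 else k := fun _ => rfl
  have hnot : monomial a (1 : K) ∉ P := by
    rw [← prod_X_pow_eq_monomial, hprime.prod_mem_iff]
    rintro ⟨v, hv, hvP⟩
    have := hprime.mem_of_pow_mem _ hvP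
    rw [Finsupp.mem_support_iff, ha, if_pos this] at hv
    exact hv rfl
  rw [hmem, mem_indIdeal_pow] at hnot
  push Not at hnot
  obtain ⟨s, hs, hdom⟩ := hnot
  rw [mem_support_iff, coeff_monomial_mul'] at hs
  obtain ⟨has, hs⟩ := ite_ne_right_iff.1 hs
  rw [one_mul] at hs
  refine ⟨a, (s - a : Fin n →₀ ℕ), fun v hv => by rw [ha, if_neg hv], ?_, fun v hv => ?_⟩
  · rwa [← Finsupp.coe_add, add_tsub_cancel_of_le has]
  · have := mem_indIdeal_pow.1 ((hmem _).1 hv) (Finsupp.single v 1 + (s - a)) (by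
      rw [support_X_mul, Finset.mem_map]
      exact ⟨_, mem_support_iff.2 hs, rfl⟩)
    rwa [Finsupp.coe_add, Finsupp.single_eq_pi_single] at this

/-- The connected components of an induced subgraph of a path graph are the maximal intervals
contained in its vertex set. -/
lemma pathGraph_induce_exists_interval {n : ℕ} {A : Set (Fin n)}
    (c : ((SimpleGraph.pathGraph n).induce A).ConnectedComponent) :
    ∃ p q : ℕ, p ≤ q ∧ q < n ∧ (∀ x : Fin n, p ≤ x → (x : ℕ) ≤ q → x ∈ A) ∧
      (∀ x : Fin n, (x : ℕ) + 1 = p → x ∉ A) ∧ (∀ x : Fin n, (x : ℕ) = q + 1 → x ∉ A) ∧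
      Nat.card c.supp = q - p + 1 := by
  classical
  obtain ⟨x, rfl⟩ := c.exists_rep
  have hx : ∀ y : Fin n, (x.1 : ℕ) ≤ y → (y : ℕ) ≤ x.1 → y ∈ A := fun y h1 h2 => by
    rw [show y = x.1 from Fin.ext (le_antisymm h2 h1)]
    exact x.2
  have hleft : ∃ p : ℕ, p ≤ x.1 ∧ ∀ y : Fin n, p ≤ y → (y : ℕ) ≤ x.1 → y ∈ A :=
    ⟨x.1, le_rfl, hx⟩
  obtain ⟨hpx, hpA⟩ := Nat.find_spec hleft
  have hpmin := fun r => Nat.find_min (H := hleft) (m := r)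
  set p := Nat.find hleft
  let R : ℕ → Prop := fun q => (x.1 : ℕ) ≤ q ∧ ∀ y : Fin n, (x.1 : ℕ) ≤ y → (y : ℕ) ≤ q → y ∈ A
  have hxn := x.1.2
  obtain ⟨hxq, hqA⟩ := Nat.findGreatest_spec (P := R) (n := n - 1) (m := x.1) (by omega)
    ⟨le_rfl, hx⟩
  have hqn := Nat.findGreatest_le (P := R) (n - 1)
  have hqmax := fun r => Nat.findGreatest_is_greatest (P := R) (n := n - 1) (k := r)
  set q := Nat.findGreatest R (n - 1)
  have hA : ∀ y : Fin n, p ≤ y → (y : ℕ) ≤ q → y ∈ A := fun y h1 h2 =>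
    (le_total (y : ℕ) x.1).elim (hpA y h1) fun h => hqA y h h2
  have hp' : ∀ y : Fin n, (y : ℕ) + 1 = p → y ∉ A := by
    intro y hy hyA
    refine hpmin y (by omega) ⟨by omega, fun z h1 h2 => ?_⟩
    rcases h1.eq_or_lt with h | h
    · rwa [← Fin.ext h]
    · exact hpA z (by omega) h2
  have hq' : ∀ y : Fin n, (y : ℕ) = q + 1 → y ∉ A := by
    intro y hy hyA
    refine hqmax y (by omega) (by omega) ⟨by omega, fun z h1 h2 => ?_⟩
    rcases h2.eq_or_lt with h | h
    · rwa [Fin.ext h]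
    · exact hqA z h1 (by omega)
  clear_value p q
  refine ⟨p, q, hpx.trans hxq, by omega, hA, hp', hq', ?_⟩
  set G := (SimpleGraph.pathGraph n).induce A with hG
  have hadj : ∀ y z : A, G.Adj y z ↔ (y.1 : ℕ) + 1 = z.1 ∨ (z.1 : ℕ) + 1 = y.1 := by
    intro y z
    rw [hG, SimpleGraph.induce_adj, SimpleGraph.pathGraph_adj]
  have hup : ∀ d (y z : A), p ≤ y.1 → (z.1 : ℕ) ≤ q → (z.1 : ℕ) = y.1 + d → G.Reachable y z := by
    intro d
    induction d with
    | zero =>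
      intro y z _ _ h
      rw [show z = y from Subtype.ext (Fin.ext (by omega))]
    | succ d ih =>
      intro y z hy hz h
      have hw : (y.1 : ℕ) + d < n := by have := z.1.2; omega
      let w : A := ⟨⟨y.1 + d, hw⟩, hA _ (by simp only; omega) (by simp only; omega)⟩
      refine (ih y w hy (by simp only [w]; omega) rfl).trans (SimpleGraph.Adj.reachable ?_)
      rw [hadj]
      simp only [w]
      omega
  have hclosed : ∀ y z : A, G.Walk y z →
      (p ≤ y.1 ∧ (y.1 : ℕ) ≤ q) → p ≤ z.1 ∧ (z.1 : ℕ) ≤ q := by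
    intro y z w
    induction w with
    | nil => exact id
    | @cons a b _ h _ ih =>
      intro ha
      refine ih ?_
      have h1 : (b.1 : ℕ) + 1 ≠ p := fun h => hp' b.1 h b.2
      have h2 : (b.1 : ℕ) ≠ q + 1 := fun h => hq' b.1 h b.2
      rw [hadj] at h
      omega
  have hmem : ∀ y : A, G.Reachable y x ↔ p ≤ y.1 ∧ (y.1 : ℕ) ≤ q := by
    intro y
    constructor
    · rintro ⟨w⟩
      exact hclosed _ _ w.reverse ⟨hpx, hxq⟩
    · rintro ⟨h1, h2⟩
      rcases le_total (y.1 : ℕ) x.1 with h | h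
      · exact hup (x.1 - y.1) y x h1 hxq (by omega)
      · exact (hup (y.1 - x.1) x y hpx h2 (by omega)).symm
  have hcard : Nat.card (Finset.Icc p q) = q - p + 1 := by
    rw [Nat.card_eq_fintype_card, Fintype.card_coe, Nat.card_Icc]
    omega
  rw [← hcard]
  refine Nat.card_congr ⟨fun y => ⟨y.1.1, ?_⟩, fun y => ⟨⟨⟨y.1, ?_⟩, ?_⟩, ?_⟩,
    fun _ => rfl, fun _ => rfl⟩
  · exact Finset.mem_Icc.2 ((hmem y.1).1 (SimpleGraph.ConnectedComponent.exact y.2))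
  · have := Finset.mem_Icc.1 y.2
    omega
  · exact hA _ (Finset.mem_Icc.1 y.2).1 (Finset.mem_Icc.1 y.2).2
  · exact SimpleGraph.ConnectedComponent.sound ((hmem _).2 (Finset.mem_Icc.1 y.2))

/-- Let `n ≥ 2t`, `k ≥ 1` and let `P` be an associated prime of `Iᵏ`.  If
`A = {x_v : x_v ∉ P}`, then every connected component of the induced subgraph
`Pₙ[A]` of the path graph has an even number of vertices. -/
theorem stmt8 (K : Type*) [Field K] (n t k : ℕ) (ht : 1 < t) (hn2 : 1 < n)
    (hn : 2 * t ≤ n) (hk : 1 ≤ k)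
    (P : Ideal (MvPolynomial (Fin n) K))
    (hP : P ∈ associatedPrimes (MvPolynomial (Fin n) K)
      (MvPolynomial (Fin n) K ⧸ (indIdeal K n t) ^ k)) :
    ∀ c : ((SimpleGraph.pathGraph n).induce
        {v : Fin n | (X v : MvPolynomial (Fin n) K) ∉ P}).ConnectedComponent,
      Even (Nat.card c.supp) := by
  intro c
  obtain ⟨a, m, ha, hnot, hdom⟩ := exists_exponent_of_mem_associatedPrimes hP
  obtain ⟨p, q, hpq, hq, hA, hp', hq', hcard⟩ := pathGraph_induce_exists_interval c
  rw [hcard, Nat.even_add_one]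
  exact DominatesIndepSets.odd_of_maximal_interval hn ha hnot
    (fun v hv => hdom v (not_not.1 hv)) hpq hq hA hp' hq'
end

section
/- Let t > 1 and n ≥ 2t - 1 be integers. Then the ideal I has the persistence property: Ass(I^k) ⊆ Ass(I^{k+1}) for every integer k ≥ 1. -/
open MvPolynomial

/-- If `(J' : I) = J`, then every associated prime of `R ⧸ J` is one of `R ⧸ J'`. -/
lemma associatedPrimes_quotient_subset_of_colon {R : Type*} [CommRing R] [IsNoetherianRing R]
    {I J J' : Ideal R} (h : ∀ f, f ∈ J ↔ ∀ g ∈ I, f * g ∈ J') :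
    associatedPrimes R (R ⧸ J) ⊆ associatedPrimes R (R ⧸ J') := by
  intro P hP
  rw [AssociatedPrimes.mem_iff, isAssociatedPrime_iff] at hP ⊢
  obtain ⟨hprime, x, hx⟩ := hP
  refine ⟨hprime, ?_⟩
  obtain ⟨f, rfl⟩ := Ideal.Quotient.mk_surjective x
  obtain ⟨G, rfl⟩ := (isNoetherianRing_iff_ideal_fg R).1 inferInstance I
  have hmem : ∀ (L : Ideal R) (r y : R),
      r ∈ (⊥ : Submodule R (R ⧸ L)).colon {Ideal.Quotient.mk L y} ↔ r * y ∈ L := by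
    intro L r y
    rw [Submodule.mem_colon_singleton, Submodule.mem_bot, ← Ideal.Quotient.eq_zero_iff_mem]
    rfl
  have hinf : P =
      G.inf fun g => (⊥ : Submodule R (R ⧸ J')).colon {Ideal.Quotient.mk J' (f * g)} := by
    ext r
    rw [hx, hmem, h, Submodule.mem_finsetInf]
    simp only [hmem]
    constructor
    · intro H g hg
      rw [← mul_assoc]
      exact H g (Ideal.subset_span hg)
    · intro H g hg
      have : Ideal.span (G : Set R) ≤ J'.colon {r * f} := by
        rw [Ideal.span_le]
        intro g hg
        rw [SetLike.mem_coe, Submodule.mem_colon_singleton, smul_eq_mul, mul_comm, mul_assoc]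
        exact H g hg
      have := this hg
      rwa [Submodule.mem_colon_singleton, smul_eq_mul, mul_comm] at this
  obtain ⟨g, hgG, hg⟩ := hprime.inf_le'.1 hinf.ge
  refine ⟨_, le_antisymm ?_ hg⟩
  conv_lhs => rw [hinf]
  exact Finset.inf_le hgG

/-- If `f I ⊆ I ^ (k + 1)`, then `f ^ m I ⊆ I ^ (k m + 1)`. -/
lemma pow_mul_mem_pow_of_mul_mem {R : Type*} [CommRing R] {I : Ideal R} {k : ℕ} {f : R}
    (h : ∀ g ∈ I, f * g ∈ I ^ (k + 1)) (m : ℕ) : ∀ g ∈ I, f ^ m * g ∈ I ^ (k * m + 1) := by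
  have key : Ideal.span {f} * I ≤ I ^ (k + 1) := by
    rw [Ideal.span_singleton_mul_le_iff]
    exact h
  suffices H : Ideal.span {f ^ m} * I ≤ I ^ (k * m + 1) by
    rwa [Ideal.span_singleton_mul_le_iff] at H
  rw [← Ideal.span_singleton_pow]
  induction m with
  | zero => simp
  | succ m ih =>
    calc Ideal.span {f} ^ (m + 1) * I = Ideal.span {f} * (Ideal.span {f} ^ m * I) := by ring
      _ ≤ Ideal.span {f} * I ^ (k * m + 1) := Ideal.mul_mono_right ih
      _ = (Ideal.span {f} * I) * I ^ (k * m) := by ring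
      _ ≤ I ^ (k + 1) * I ^ (k * m) := Ideal.mul_mono_left key
      _ = I ^ (k * (m + 1) + 1) := by ring

/-- The largest partial sums of a sequence bounded by `w` whose consecutive terms have sum
at most `k`. -/
def greedySum (w : ℕ → ℕ) (k : ℕ) : ℕ → ℕ
  | 0 => 0
  | 1 => min (w 0) k
  | i + 2 => min (greedySum w k (i + 1) + w (i + 1)) (greedySum w k i + k)

lemma greedySum_succ_le (w : ℕ → ℕ) (k i : ℕ) :
    greedySum w k (i + 1) ≤ greedySum w k i + w i := by
  cases i <;> simp [greedySum]

lemma greedySum_add_two_le (w : ℕ → ℕ) (k i : ℕ) :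
    greedySum w k (i + 2) ≤ greedySum w k i + k := by
  simp [greedySum]

lemma greedySum_mono (w : ℕ → ℕ) (k : ℕ) : Monotone (greedySum w k) := by
  suffices H : ∀ i, greedySum w k i ≤ greedySum w k (i + 1) ∧
      greedySum w k (i + 1) ≤ greedySum w k i + k from monotone_nat_of_le_succ fun i => (H i).1
  intro i
  induction i with
  | zero => simp [greedySum]
  | succ i ih =>
    have : greedySum w k (i + 2) =
      min (greedySum w k (i + 1) + w (i + 1)) (greedySum w k i + k) := rfl
    show _ ≤ greedySum w k (i + 2) ∧ greedySum w k (i + 2) ≤ _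
    omega

lemma sum_range_le_greedySum {w c : ℕ → ℕ} {k m : ℕ} (h₁ : ∀ i, c i ≤ m * w i + 1)
    (h₂ : ∀ i, c i + c (i + 1) ≤ m * k + 1) (i : ℕ) :
    ∑ j ∈ Finset.range i, c j ≤ m * greedySum w k i + i := by
  suffices H : ∑ j ∈ Finset.range i, c j ≤ m * greedySum w k i + i ∧
      ∑ j ∈ Finset.range (i + 1), c j ≤ m * greedySum w k (i + 1) + (i + 1) from H.1
  induction i with
  | zero =>
    have h₁ := h₁ 0
    have h₂ := h₂ 0
    rcases min_cases (w 0) k with h | h <;> simp [greedySum, h] <;> omega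
  | succ i ih =>
    refine ⟨ih.2, ?_⟩
    have h₁ := h₁ (i + 1)
    have h₂ := h₂ i
    rw [Finset.sum_range_succ _ (i + 1)]
    have h₃ := Finset.sum_range_succ c i
    show _ ≤ m * min (greedySum w k (i + 1) + w (i + 1)) (greedySum w k i + k) + _
    rcases min_cases (greedySum w k (i + 1) + w (i + 1)) (greedySum w k i + k) with h | h <;>
      rw [h.1, mul_add] <;> omega

/-- Extension of a vector indexed by `Fin n` to a sequence by zero. -/
def extendZero {n : ℕ} (a : Fin n → ℕ) (i : ℕ) : ℕ :=
  if h : i < n then a ⟨i, h⟩ else 0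

/-- The exponents of products of `q` monomials `x^F` with `F` independent of size `t`. -/
def indExponents (n t q : ℕ) : Set (Fin n →₀ ℕ) :=
  {s | ∃ F : Fin q → Finset (Fin n), (∀ j, IsIndepSet n (F j) ∧ (F j).card = t) ∧
    s = ∑ j, ∑ v ∈ F j, Finsupp.single v 1}

lemma sum_single_one_apply {n : ℕ} (F : Finset (Fin n)) (i : Fin n) :
    (∑ v ∈ F, Finsupp.single v 1 : Fin n →₀ ℕ) i = if i ∈ F then 1 else 0 := by
  simp [Finsupp.finsetSum_apply, Finsupp.single_apply]

lemma extendZero_add_succ_le {n t q : ℕ} {s : Fin n →₀ ℕ} (hs : s ∈ indExponents n t q) (i : ℕ) :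
    extendZero s i + extendZero s (i + 1) ≤ q := by
  obtain ⟨F, hF, rfl⟩ := hs
  have hle : ∀ v, (∑ j, ∑ v ∈ F j, Finsupp.single v 1 : Fin n →₀ ℕ) v ≤ q := by
    intro v
    rw [Finsupp.finsetSum_apply]
    simp only [sum_single_one_apply]
    refine (Finset.sum_le_card_nsmul _ _ 1 ?_).trans (by simp)
    intro j _
    split_ifs <;> simp
  unfold extendZero
  by_cases h : i + 1 < n
  · have h' : i < n := by omega
    rw [dif_pos h, dif_pos h', Finsupp.finsetSum_apply, Finsupp.finsetSum_apply,
      ← Finset.sum_add_distrib]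
    simp only [sum_single_one_apply]
    refine (Finset.sum_le_card_nsmul _ _ 1 ?_).trans (by simp)
    intro j _
    have := (hF j).1 ⟨i, h'⟩
    split_ifs with h₁ h₂ <;> simp
    exact this h₁ _ h₂ rfl
  · rw [dif_neg h]
    split_ifs
    · exact hle _
    · simp

lemma sum_range_extendZero {n t q : ℕ} {s : Fin n →₀ ℕ} (hs : s ∈ indExponents n t q) :
    ∑ i ∈ Finset.range n, extendZero s i = q * t := by
  obtain ⟨F, hF, rfl⟩ := hs
  rw [Finset.sum_range]
  simp only [extendZero, Fin.is_lt, dite_true, Fin.eta, Finsupp.finsetSum_apply]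
  rw [Finset.sum_comm]
  simp only [← Finsupp.finsetSum_apply, sum_single_one_apply]
  simp [hF]

lemma exists_indExponents_le {n t k : ℕ} {a : Fin n →₀ ℕ}
    (h : k * t ≤ greedySum (extendZero a) k n) : ∃ s ∈ indExponents n t k, s ≤ a := by
  classical
  set B := greedySum (extendZero a) k with hB
  have hmono : Monotone B := greedySum_mono _ _
  have hexists : ∀ p < k * t, ∃ i : Fin n, B i ≤ p ∧ p < B (i + 1) := by
    intro p hp
    have hex : ∃ i, p < B i := ⟨n, hp.trans_le h⟩
    have hpos : Nat.find hex ≠ 0 := by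
      intro h0
      have := Nat.find_spec hex
      rw [h0] at this
      simp [hB, greedySum] at this
    have hle : Nat.find hex ≤ n := Nat.find_min' hex (hp.trans_le h)
    refine ⟨⟨Nat.find hex - 1, by omega⟩, ?_, ?_⟩
    · exact not_lt.1 (Nat.find_min hex (Nat.sub_one_lt hpos))
    · have := Nat.find_spec hex
      simpa [Nat.sub_add_cancel (Nat.one_le_iff_ne_zero.2 hpos)] using this
  have hgap : ∀ p q i j, p + k ≤ q → B i ≤ p → q < B (j + 1) → i + 2 ≤ j := by
    intro p q i j hpq hi hj
    have h₁ : B (i + 2) ≤ B i + k := greedySum_add_two_le _ _ _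
    have h₂ : i + 2 < j + 1 := hmono.reflect_lt (by omega)
    omega
  have hstep : ∀ (j : ℕ) {l l'}, l < l' → j + l * k + k ≤ j + l' * k := by
    intro j l l' hl
    have := Nat.mul_le_mul_right k (Nat.succ_le_of_lt hl)
    rw [Nat.succ_mul] at this
    omega
  let F : Fin k → Finset (Fin n) := fun j =>
    {i | ∃ l < t, B i ≤ j + l * k ∧ j + l * k < B (i + 1)}
  have hmem : ∀ j i, i ∈ F j ↔ ∃ l < t, B i ≤ j + l * k ∧ j + l * k < B (i + 1) := by
    intro j i; simp [F]
  refine ⟨_, ⟨F, fun j => ⟨?_, ?_⟩, rfl⟩, ?_⟩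
  · intro i hi i' hi' hii'
    obtain ⟨l, -, h₁, h₂⟩ := (hmem _ _).1 hi
    obtain ⟨l', -, h₁', h₂'⟩ := (hmem _ _).1 hi'
    rcases lt_trichotomy l l' with hl | rfl | hl
    · have := hgap _ _ _ _ (hstep j hl) h₁ h₂'
      omega
    · rw [← hii'] at h₁'
      omega
    · have := hgap _ _ _ _ (hstep j hl) h₁' h₂
      omega
  · have hlt : ∀ l < t, (j : ℕ) + l * k < k * t := by
      intro l hl
      have := Nat.mul_le_mul_right k (Nat.succ_le_of_lt hl)
      rw [Nat.succ_mul] at this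
      have := j.is_lt
      rw [mul_comm k t]
      omega
    choose g hg₁ hg₂ using hexists
    symm
    rw [← Finset.card_range t]
    refine Finset.card_bij (fun l hl => g _ (hlt l (Finset.mem_range.1 hl))) ?_ ?_ ?_
    · intro l hl
      exact (hmem _ _).2 ⟨l, Finset.mem_range.1 hl, hg₁ _ _, hg₂ _ _⟩
    · intro l hl l' hl' heq
      have hl₀ := hlt l (Finset.mem_range.1 hl)
      have hl₀' := hlt l' (Finset.mem_range.1 hl')
      have heq : g _ hl₀ = g _ hl₀' := heq
      rcases lt_trichotomy l l' with hll | hll | hll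
      · have := hgap _ _ _ _ (hstep j hll) (hg₁ _ hl₀) (hg₂ _ hl₀')
        rw [heq] at this
        omega
      · exact hll
      · have := hgap _ _ _ _ (hstep j hll) (hg₁ _ hl₀') (hg₂ _ hl₀)
        rw [heq] at this
        omega
    · intro i hi
      obtain ⟨l, hl, h₁, h₂⟩ := (hmem _ _).1 hi
      refine ⟨l, Finset.mem_range.2 hl, Fin.ext ?_⟩
      have h₃ := hg₁ _ (hlt l hl)
      have h₄ := hg₂ _ (hlt l hl)
      have h₅ := hmono.reflect_lt (h₁.trans_lt h₄)
      have h₆ := hmono.reflect_lt (h₃.trans_lt h₂)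
      omega
  · intro i
    rw [Finsupp.finsetSum_apply]
    simp only [sum_single_one_apply]
    rw [← Finset.card_filter]
    have hsucc : B (i + 1) ≤ B i + a i := by
      simpa [extendZero] using greedySum_succ_le (extendZero a) k i
    calc Finset.card {j | i ∈ F j}
        = (Finset.image Fin.val ({j | i ∈ F j} : Finset (Fin k))).card :=
          (Finset.card_image_of_injective _ Fin.val_injective).symm
      _ ≤ (Finset.image (· % k) (Finset.Ico (B i) (B (i + 1)))).card := by
          refine Finset.card_le_card ?_
          intro p hp
          simp only [Finset.mem_image, Finset.mem_filter, Finset.mem_univ, true_and, hmem] at hp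
          obtain ⟨j, ⟨l, -, h₁, h₂⟩, rfl⟩ := hp
          refine Finset.mem_image.2 ⟨j + l * k, Finset.mem_Ico.2 ⟨h₁, h₂⟩, ?_⟩
          simp [Nat.mod_eq_of_lt j.is_lt]
      _ ≤ (Finset.Ico (B i) (B (i + 1))).card := Finset.card_image_le
      _ ≤ a i := by rw [Nat.card_Ico]; omega

lemma monomial_sum_single_one (K : Type*) [Field K] {n : ℕ} (F : Finset (Fin n)) :
    monomial (∑ v ∈ F, Finsupp.single v 1) (1 : K) = ∏ v ∈ F, X v :=
  monomial_sum_one F _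

lemma indIdeal_pow_eq_span (K : Type*) [Field K] (n t q : ℕ) :
    indIdeal K n t ^ q = Ideal.span ((fun s => monomial s (1 : K)) '' indExponents n t q) := by
  induction q with
  | zero =>
    have : indExponents n t 0 = {0} := by
      ext s
      simp [indExponents]
    simp [this]
  | succ q ih =>
    rw [pow_succ', ih, indIdeal, Ideal.span_mul_span']
    congr 1
    ext p
    simp only [Set.mem_mul, Set.mem_image, Set.mem_ofPred_eq]
    constructor
    · rintro ⟨_, ⟨F, h₁, h₂, rfl⟩, _, ⟨_, ⟨G, hG, rfl⟩, rfl⟩, rfl⟩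
      refine ⟨_, ⟨Fin.cons F G, ?_, rfl⟩, ?_⟩
      · intro j
        refine Fin.cases ?_ (fun j => ?_) j
        · exact ⟨h₁, h₂⟩
        · exact hG j
      · rw [Fin.sum_univ_succ, ← monomial_sum_single_one, monomial_mul, one_mul]
        simp
    · rintro ⟨_, ⟨G, hG, rfl⟩, rfl⟩
      refine ⟨_, ⟨G 0, (hG 0).1, (hG 0).2, rfl⟩, _,
        ⟨_, ⟨fun j => G j.succ, fun j => hG _, rfl⟩, rfl⟩, ?_⟩
      rw [Fin.sum_univ_succ, ← monomial_sum_single_one, monomial_mul, one_mul]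

lemma exists_isIndepSet_card_s9 {n t : ℕ} (hn : 2 * t - 1 ≤ n) :
    ∃ F : Finset (Fin n), IsIndepSet n F ∧ F.card = t := by
  refine ⟨Finset.univ.map ⟨fun i : Fin t => (⟨2 * i, by omega⟩ : Fin n), ?_⟩, ?_, by simp⟩
  · intro i j h
    simp at h
    omega
  · intro i hi j hj
    simp only [Finset.mem_map, Finset.mem_univ, true_and] at hi hj
    obtain ⟨i, rfl⟩ := hi
    obtain ⟨j, rfl⟩ := hj
    show 2 * (i : ℕ) + 1 ≠ 2 * (j : ℕ)
    omega

lemma exists_indExponents_le_of_mul_mem (K : Type*) [Field K] {n t k : ℕ} (ht : 0 < t)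
    (hn : 2 * t - 1 ≤ n) {a : Fin n →₀ ℕ}
    (h : ∀ g ∈ indIdeal K n t, monomial a (1 : K) * g ∈ indIdeal K n t ^ (k + 1)) :
    ∃ s ∈ indExponents n t k, s ≤ a := by
  obtain ⟨F, hF, hcard⟩ := exists_isIndepSet_card_s9 hn
  have hmem := pow_mul_mem_pow_of_mul_mem h n _ (Ideal.subset_span ⟨F, hF, hcard, rfl⟩)
  rw [← monomial_sum_single_one, monomial_pow, monomial_mul, one_pow, one_mul,
    indIdeal_pow_eq_span, mem_ideal_span_monomial_image] at hmem
  obtain ⟨s, hs, hle⟩ := hmem _ (mem_support_iff.2 (by rw [coeff_monomial, if_pos rfl]; exact one_ne_zero))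
  refine exists_indExponents_le ?_
  have hbound := sum_range_le_greedySum (w := extendZero a) (c := extendZero s) (k := k) (m := n)
    (fun i => ?_) (fun i => ?_) n
  · rw [sum_range_extendZero hs] at hbound
    by_contra! hlt
    have := Nat.mul_le_mul_left n (Nat.succ_le_of_lt hlt)
    nlinarith
  · unfold extendZero
    split_ifs with hi
    · refine (hle ⟨i, hi⟩).trans ?_
      rw [Finsupp.add_apply, sum_single_one_apply, Finsupp.smul_apply, smul_eq_mul]
      split_ifs <;> omega
    · simp
  · rw [mul_comm n k]
    exact extendZero_add_succ_le hs i

/-- Powers of `Ind_t(Pₙ)` satisfy `(I ^ (k + 1) : I) = I ^ k`. -/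
lemma mem_indIdeal_pow_iff_s9 (K : Type*) [Field K] {n t : ℕ} (ht : 0 < t) (hn : 2 * t - 1 ≤ n)
    (k : ℕ) (f : MvPolynomial (Fin n) K) :
    f ∈ indIdeal K n t ^ k ↔ ∀ g ∈ indIdeal K n t, f * g ∈ indIdeal K n t ^ (k + 1) := by
  refine ⟨fun hf g hg => pow_succ (indIdeal K n t) k ▸ Ideal.mul_mem_mul hf hg, fun h => ?_⟩
  rw [indIdeal_pow_eq_span, mem_ideal_span_monomial_image]
  intro a ha
  refine exists_indExponents_le_of_mul_mem K ht hn fun g hg => ?_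
  suffices H : indIdeal K n t ≤ (indIdeal K n t ^ (k + 1)).colon {monomial a (1 : K)} by
    have := H hg
    rwa [Submodule.mem_colon_singleton, smul_eq_mul, mul_comm] at this
  conv_lhs => rw [indIdeal]
  rw [Ideal.span_le]
  rintro _ ⟨F, hF, hcard, rfl⟩
  rw [SetLike.mem_coe, Submodule.mem_colon_singleton, smul_eq_mul, mul_comm]
  have hF' := h _ (Ideal.subset_span ⟨F, hF, hcard, rfl⟩)
  rw [← monomial_sum_single_one, indIdeal_pow_eq_span, mem_ideal_span_monomial_image] at hF' ⊢
  intro b hb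
  rw [monomial_mul, one_mul, mem_support_iff, coeff_monomial] at hb
  obtain rfl := (ite_ne_right_iff.1 hb).1
  refine hF' _ ?_
  rw [mem_support_iff, coeff_mul_monomial, mul_one]
  exact mem_support_iff.1 ha

/-- For `t > 1` and `n ≥ 2t - 1`, the ideal `I = Ind_t(Pₙ)` has the persistence
property: `Ass(Iᵏ) ⊆ Ass(Iᵏ⁺¹)` for every `k ≥ 1`. -/
theorem stmt9 (K : Type*) [Field K] (t n : ℕ) (ht : 1 < t) (hn : 2 * t - 1 ≤ n) :
    ∀ k : ℕ, 1 ≤ k →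
      associatedPrimes (MvPolynomial (Fin n) K)
          (MvPolynomial (Fin n) K ⧸ (indIdeal K n t) ^ k) ⊆
        associatedPrimes (MvPolynomial (Fin n) K)
          (MvPolynomial (Fin n) K ⧸ (indIdeal K n t) ^ (k + 1)) := by
  intro k _
  exact associatedPrimes_quotient_subset_of_colon
    (mem_indIdeal_pow_iff_s9 K (by omega) hn k)
end

section
/- Let t > 1 and n = 2t. Then I is generated by the t + 1 monomials g_0, g_1, …, g_t, where g_i = (x_1 x_3 ⋯ x_{2i-1}) · (x_{2i+2} x_{2i+4} ⋯ x_{2t}) for 0 ≤ i ≤ t (so g_0 = x_2 x_4 ⋯ x_{2t} and g_t = x_1 x_3 ⋯ x_{2t-1}); that is, I = ⟨x_1 x_3 ⋯ x_{2t-1}, x_1 x_3 ⋯ x_{2t-3} x_{2t}, …, x_1 x_4 x_6 ⋯ x_{2t}, x_2 x_4 ⋯ x_{2t}⟩. -/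
open MvPolynomial

/-- The generator `gᵢ = x₁x₃⋯x_{2i-1} · x_{2i+2}x_{2i+4}⋯x_{2t}` of `Ind_t(P_{2t})`:
the `j`-th factor (for `0 ≤ j < t`) is `x_{2j+1}` if `j < i` and `x_{2j+2}` otherwise
(0-based variable indices `2j` resp. `2j+1`). -/
noncomputable def gGen (K : Type*) [Field K] (t i : ℕ) : MvPolynomial (Fin (2 * t)) K :=
  ∏ j : Fin t, X (⟨if (j : ℕ) < i then 2 * (j : ℕ) else 2 * (j : ℕ) + 1, by
    have hj := j.isLt; split <;> omega⟩ : Fin (2 * t))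

/-- The index of the `j`-th variable of the generator `gGen K t i`. -/
def genVertex (t i : ℕ) (j : Fin t) : Fin (2 * t) :=
  ⟨if (j : ℕ) < i then 2 * (j : ℕ) else 2 * (j : ℕ) + 1, by
    have hj := j.isLt; split <;> omega⟩

theorem genVertex_val (t i : ℕ) (j : Fin t) :
    (genVertex t i j : ℕ) = if (j : ℕ) < i then 2 * (j : ℕ) else 2 * (j : ℕ) + 1 := rfl

theorem genVertex_injective (t i : ℕ) : Function.Injective (genVertex t i) := by
  intro a b h
  have h' := congrArg Fin.val h
  simp only [genVertex_val] at h'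
  ext
  split_ifs at h' <;> omega

theorem gGen_eq_prod_image (K : Type*) [Field K] (t i : ℕ) :
    gGen K t i = ∏ v ∈ Finset.univ.image (genVertex t i), X v := by
  rw [Finset.prod_image (genVertex_injective t i).injOn]
  rfl

theorem card_image_genVertex (t i : ℕ) : (Finset.univ.image (genVertex t i)).card = t := by
  rw [Finset.card_image_of_injective _ (genVertex_injective t i), Finset.card_univ,
    Fintype.card_fin]

theorem isIndepSet_image_genVertex (t i : ℕ) :
    IsIndepSet (2 * t) (Finset.univ.image (genVertex t i)) := by
  simp only [IsIndepSet, Finset.mem_image, Finset.mem_univ, true_and]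
  rintro _ ⟨a, rfl⟩ _ ⟨b, rfl⟩
  simp only [genVertex_val]
  split_ifs <;> omega

/-- An independent set of size `t` in `P_{2t}` meets each pair of vertices `2j`, `2j + 1`. -/
theorem IsIndepSet.exists_mem_pair {t : ℕ} {F : Finset (Fin (2 * t))}
    (hF : IsIndepSet (2 * t) F) (hcard : F.card = t) {j : ℕ} (hj : j < t) :
    ∃ w ∈ F, (w : ℕ) = 2 * j ∨ (w : ℕ) = 2 * j + 1 := by
  have hinj : Set.InjOn (fun w : Fin (2 * t) => (w : ℕ) / 2) F := by
    intro a ha b hb h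
    have h₁ := hF a ha b hb
    have h₂ := hF b hb a ha
    ext
    dsimp only at h
    omega
  have himage : F.image (fun w : Fin (2 * t) => (w : ℕ) / 2) = Finset.range t := by
    apply Finset.eq_of_subset_of_card_le
    · intro k hk
      obtain ⟨w, -, rfl⟩ := Finset.mem_image.1 hk
      have := w.isLt
      exact Finset.mem_range.2 (by omega)
    · rw [Finset.card_image_of_injOn hinj, Finset.card_range, hcard]
  obtain ⟨w, hw, hwj⟩ := Finset.mem_image.1 (himage ▸ Finset.mem_range.2 hj)
  exact ⟨w, hw, by omega⟩

/-- Every independent set of size `t` in `P_{2t}` is the support of some `gGen K t i`. -/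
theorem IsIndepSet.exists_eq_image_genVertex {t : ℕ} {F : Finset (Fin (2 * t))}
    (hF : IsIndepSet (2 * t) F) (hcard : F.card = t) :
    ∃ i ≤ t, F = Finset.univ.image (genVertex t i) := by
  classical
  have hex : ∃ i, t ≤ i ∨ ∃ w ∈ F, (w : ℕ) = 2 * i + 1 := ⟨t, Or.inl le_rfl⟩
  obtain ⟨i, hi, hmin⟩ : ∃ i, (t ≤ i ∨ ∃ w ∈ F, (w : ℕ) = 2 * i + 1) ∧
      ∀ j < i, ¬(t ≤ j ∨ ∃ w ∈ F, (w : ℕ) = 2 * j + 1) :=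
    ⟨Nat.find hex, Nat.find_spec hex, fun _ => Nat.find_min hex⟩
  have hodd : ∀ j, i ≤ j → j < t → ∃ w ∈ F, (w : ℕ) = 2 * j + 1 := by
    intro j hij
    induction j, hij using Nat.le_induction with
    | base => exact fun hit => hi.resolve_left (by omega)
    | succ j hij ih =>
      intro hjt
      obtain ⟨v, hv, hvj⟩ := ih (by omega)
      obtain ⟨w, hw, hwj⟩ := hF.exists_mem_pair hcard hjt
      have := hF v hv w hw
      exact ⟨w, hw, by omega⟩
  refine ⟨i, ?_, (Finset.eq_of_subset_of_card_le ?_ ?_).symm⟩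
  · by_contra! h
    exact hmin t h (Or.inl le_rfl)
  · intro v hv
    obtain ⟨j, -, rfl⟩ := Finset.mem_image.1 hv
    have hval := genVertex_val t i j
    obtain ⟨w, hw, hwv⟩ : ∃ w ∈ F, (w : ℕ) = genVertex t i j := by
      split_ifs at hval with hji
      · obtain ⟨w, hw, hwj⟩ := hF.exists_mem_pair hcard j.isLt
        have hne : (w : ℕ) ≠ 2 * j + 1 := fun h => hmin j hji (Or.inr ⟨w, hw, h⟩)
        exact ⟨w, hw, by omega⟩
      · obtain ⟨w, hw, hwj⟩ := hodd j (by omega) j.isLt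
        exact ⟨w, hw, by omega⟩
    rwa [← Fin.ext hwv]
  · rw [card_image_genVertex, hcard]

/-- For `n = 2t`, the ideal `I = Ind_t(P_{2t})` is generated by the `t + 1` monomials
`g₀, g₁, …, g_t`, where `gᵢ = (x₁x₃⋯x_{2i-1})·(x_{2i+2}x_{2i+4}⋯x_{2t})`. -/
theorem stmt14 (K : Type*) [Field K] (t : ℕ) (ht : 1 < t) :
    indIdeal K (2 * t) t = Ideal.span {p | ∃ i ≤ t, p = gGen K t i} := by
  refine congrArg Ideal.span (Set.ext fun p => ⟨?_, ?_⟩)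
  · rintro ⟨F, hF, hcard, rfl⟩
    obtain ⟨i, hi, rfl⟩ := hF.exists_eq_image_genVertex hcard
    exact ⟨i, hi, (gGen_eq_prod_image K t i).symm⟩
  · rintro ⟨i, -, rfl⟩
    exact ⟨_, isIndepSet_image_genVertex t i, card_image_genVertex t i, gGen_eq_prod_image K t i⟩
end
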